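/- Suppose the cost has the form c(x,m) = G(∫ F(x,y) m(dy)) and that G'(0) > −∞. Then for every μ ∈ P(X) and ν ∈ P(Y), there exists a bounded measurable function f̄ : Y → ℝ such that I_c(μ,ν) = ∫ K_c f̄(x) μ(dx) − ∫ f̄(y) ν(dy). The same conclusion holds if G'(0) = −∞ and Y is a finite set. Moreover, if G is non-decreasing (resp. non-increasing) on [0,+∞), then f̄ can be chosen nonpositive (resp. nonnegative). -/

import Mathlib

open MeasureTheory ProbabilityTheory Topology Filter Set Metric
open scoped NNReal ENNReal

noncomputable section

namespace UWOT

/-- The nonnegative part of an extended real, as an extended nonnegative real. -/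
def epos (x : EReal) : ℝ≥0∞ := if x = ⊤ then ⊤ else ENNReal.ofReal x.toReal

/-- Integral of an `EReal`-valued function: positive part minus negative part. -/
def eintegral {α : Type*} [MeasurableSpace α] (μ : Measure α) (g : α → EReal) : EReal :=
  ((∫⁻ x, epos (g x) ∂μ : ℝ≥0∞) : EReal) - ((∫⁻ x, epos (-(g x)) ∂μ : ℝ≥0∞) : EReal)

/-- Integral of a real-valued function, with value `+∞` when the positive part is not
integrable.  This is the integral "understood in `ℝ ∪ {+∞}`". -/
def eintegralR {α : Type*} [MeasurableSpace α] (μ : Measure α) (f : α → ℝ) : EReal :=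
  eintegral μ fun x => (f x : EReal)

variable {X Y : Type*}
  [TopologicalSpace X] [PolishSpace X] [MeasurableSpace X] [BorelSpace X]
  [TopologicalSpace Y] [PolishSpace Y] [MeasurableSpace Y] [BorelSpace Y]

/-- A nonnegative kernel from `X` to `Y` : a measurable family of finite nonnegative
measures on `Y`. -/
def IsKernel (q : X → FiniteMeasure Y) : Prop :=
  Measurable fun x => (q x : Measure Y)

/-- `μ q = ν` : the kernel `q` transports `μ` onto `ν`. -/
def Transports (μ : Measure X) (q : X → FiniteMeasure Y) (ν : Measure Y) : Prop :=
  μ.bind (fun x => (q x : Measure Y)) = ν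

/-- The transport cost `I_c(μ,ν)`, an infimum in `ℝ ∪ {+∞}` (it equals `⊤` when no
admissible kernel exists). -/
def transportCost (c : X → FiniteMeasure Y → ℝ) (μ : Measure X) (ν : Measure Y) : EReal :=
  sInf {r : EReal | ∃ q : X → FiniteMeasure Y,
    IsKernel q ∧ Transports μ q ν ∧ r = eintegralR μ fun x => c x (q x)}

/-- Standing assumptions on the cost function: convexity in the second variable, joint
lower semicontinuity, and the lower bound (LB). -/
structure IsCost (c : X → FiniteMeasure Y → ℝ) : Prop where
  convex : ∀ (x : X) (m₀ m₁ : FiniteMeasure Y) (t : ℝ≥0), t ≤ 1 →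
    c x ((1 - t) • m₀ + t • m₁) ≤ (1 - (t : ℝ)) * c x m₀ + (t : ℝ) * c x m₁
  lsc : LowerSemicontinuous fun p : X × FiniteMeasure Y => c p.1 p.2
  lb : ∃ r₀ r₁ : ℝ, ∀ (x : X) (m : FiniteMeasure Y), r₀ + r₁ * (m.mass : ℝ) ≤ c x m

/-- The topological support of a measure. -/
def msupport {Z : Type*} [TopologicalSpace Z] [MeasurableSpace Z] (μ : Measure Z) : Set Z :=
  {x | ∀ U : Set Z, IsOpen U → x ∈ U → 0 < μ U}

/-- Membership in `Π(≪ μ, ν)`. -/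
def MemPiAC (μ : Measure X) (ν : Measure Y) (π : ProbabilityMeasure (X × Y)) : Prop :=
  (π : Measure (X × Y)).fst ≪ μ ∧ (π : Measure (X × Y)).snd = ν

/-- Membership in `Π(Supp(μ), ν)`. -/
def MemPiSupp (μ : Measure X) (ν : Measure Y) (π : ProbabilityMeasure (X × Y)) : Prop :=
  (π : Measure (X × Y)).fst (msupport μ) = 1 ∧ (π : Measure (X × Y)).snd = ν

variable [Nonempty Y]

/-- The disintegration kernel `π^x` of `π` with respect to its first marginal, as a
finite (probability) measure. -/
def condFM (π : ProbabilityMeasure (X × Y)) (x : X) : FiniteMeasure Y :=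
  ⟨(π : Measure (X × Y)).condKernel x, inferInstance⟩

/-- The measure `(dπ₁/dμ)(x) • π^x`. -/
def fiber (μ : Measure X) (π : ProbabilityMeasure (X × Y)) (x : X) : FiniteMeasure Y :=
  ((π : Measure (X × Y)).fst.rnDeriv μ x).toNNReal • condFM π x

/-- The functional `I_c^μ[π] = ∫ c(x, (dπ₁/dμ)(x) π^x) dμ`, in `ℝ ∪ {+∞}`. -/
def Icmu (c : X → FiniteMeasure Y → ℝ) (μ : Measure X) (π : ProbabilityMeasure (X × Y)) :
    EReal :=
  eintegralR μ fun x => c x (fiber μ π x)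

/-- A strong solution of the transport problem. -/
def IsStrongSol (c : X → FiniteMeasure Y → ℝ) (μ : Measure X) (ν : Measure Y)
    (π : ProbabilityMeasure (X × Y)) : Prop :=
  MemPiAC μ ν π ∧ Icmu c μ π = transportCost c μ ν

/-- A weak solution of the transport problem. -/
def IsWeakSol (c : X → FiniteMeasure Y → ℝ) (μ : Measure X) (ν : Measure Y)
    (π : ProbabilityMeasure (X × Y)) : Prop :=
  ∃ s : ℕ → ProbabilityMeasure (X × Y), (∀ n, MemPiAC μ ν (s n)) ∧
    Tendsto s atTop (𝓝 π) ∧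
    Tendsto (fun n => Icmu c μ (s n)) atTop (𝓝 (transportCost c μ ν))

/-- The recession function `c'_∞(x,m) = lim_{λ→∞} c(x, λm)/λ`. -/
def recession (c : X → FiniteMeasure Y → ℝ) (x : X) (m : FiniteMeasure Y) : EReal :=
  limsup (fun lam : ℝ≥0 => ((c x (lam • m) / (lam : ℝ) : ℝ) : EReal)) atTop

/-- The extended functional `bar I_c^μ[π]`. -/
def barI (c : X → FiniteMeasure Y → ℝ) (μ : Measure X) (π : ProbabilityMeasure (X × Y)) :
    EReal :=
  eintegralR μ (fun x => c x (fiber μ π x)) +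
    eintegral ((π : Measure (X × Y)).fst.singularPart μ) (fun x => recession c x (condFM π x))

/-- Assumption (A). -/
def AssumpA (c : X → FiniteMeasure Y → ℝ) : Prop :=
  ∃ (a : ℕ → C(X, ℝ)) (b : ℕ → C(X × Y, ℝ)),
    ∀ (x : X) (m : FiniteMeasure Y),
      IsLUB (range fun k => (∫ y, b k (x, y) ∂(m : Measure Y)) + a k x) (c x m)

/-- Assumption (B). -/
def AssumpB (c : X → FiniteMeasure Y → ℝ) : Prop :=
  ∀ (x : X) (m : FiniteMeasure Y), m ≠ 0 →
    Tendsto (fun lam : ℝ≥0 => c x (lam • m) / (lam : ℝ)) atTop atTop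

/-- Assumption (C). -/
def AssumpC (c : X → FiniteMeasure Y → ℝ) : Prop :=
  (∀ m : FiniteMeasure Y, Continuous fun x : X => c x m) ∧
  (∀ m : FiniteMeasure Y, Continuous fun x : X => recession c x m) ∧
  (∃ a : ℝ, 0 ≤ a ∧
    ∀ (x : X) (p : FiniteMeasure Y), p.mass = 1 → recession c x p ≤ (a : EReal))

/-- Assumption (Approx). -/
def AssumpApprox (c : X → FiniteMeasure Y → ℝ) : Prop :=
  ∀ (μ : Measure X) (ν : Measure Y), IsProbabilityMeasure μ → IsProbabilityMeasure ν →
    ∀ π : ProbabilityMeasure (X × Y), MemPiSupp μ ν π →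
      ∃ s : ℕ → ProbabilityMeasure (X × Y), (∀ n, MemPiAC μ ν (s n)) ∧
        Tendsto (fun n => Icmu c μ (s n)) atTop (𝓝 (barI c μ π))

/-- The operator `K_c` acting on continuous functions. -/
def Kc (c : X → FiniteMeasure Y → ℝ) (f : Y → ℝ) (x : X) : EReal :=
  ⨅ m : FiniteMeasure Y, (((∫ y, f y ∂(m : Measure Y)) + c x m : ℝ) : EReal)


/-- The cost `c(x,m) = G(∫ F(x,y) m(dy))`. -/
def cGF (F : X → Y → ℝ) (G : ℝ → ℝ) (x : X) (m : FiniteMeasure Y) : ℝ :=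
  G (∫ y, F x y ∂(m : Measure Y))

/-- The operator `K_c` acting on (merely integrable) functions:
`K_c f(x) = inf { ∫ f dm + c(x,m) : m ∈ M(Y), ∫ |f| dm < ∞ }`. -/
def KcL1 (c : X → FiniteMeasure Y → ℝ) (f : Y → ℝ) (x : X) : EReal :=
  ⨅ m : {m : FiniteMeasure Y // Integrable f (m : Measure Y)},
    (((∫ y, f y ∂((m : FiniteMeasure Y) : Measure Y)) + c x (m : FiniteMeasure Y) : ℝ) :
      EReal)

/-- Convex separation in `L²`: a lower bound for the ordinates of a convex set, valid up to an
asymmetric `L¹` penalty of the abscissae, is realised by a multiplier bounded by the penalty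
constants. -/
lemma exists_multiplier_of_penalty {Ω : Type*} [MeasurableSpace Ω] (ν : Measure Ω)
    [IsFiniteMeasure ν] (S : Set (Lp ℝ 2 ν × ℝ)) (hSconv : Convex ℝ S) (hSne : S.Nonempty)
    (V Cp Cm : ℝ) (hCp : 0 ≤ Cp) (hCm : 0 ≤ Cm)
    (hS : ∀ p ∈ S, V ≤ p.2 + (Cp * ∫ y, max (p.1 y) 0 ∂ν + Cm * ∫ y, max (-p.1 y) 0 ∂ν)) :
    ∃ f : Ω → ℝ, Measurable f ∧ (∀ y, -Cm ≤ f y ∧ f y ≤ Cp) ∧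
      ∀ p ∈ S, V ≤ p.2 + ∫ y, f y * p.1 y ∂ν := by
  set P : Lp ℝ 2 ν → ℝ := fun h =>
    Cp * ∫ y, max (h y) 0 ∂ν + Cm * ∫ y, max (-h y) 0 ∂ν with hP
  have hint : ∀ h : Lp ℝ 2 ν, Integrable h ν := fun h =>
    (Lp.memLp h).integrable (by norm_num)
  have hintp : ∀ h : Lp ℝ 2 ν, Integrable (fun y => max (h y) 0) ν := fun h => (hint h).pos_part
  have hintn : ∀ h : Lp ℝ 2 ν, Integrable (fun y => max (-h y) 0) ν := fun h => (hint h).neg_part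
  have hIcont : Continuous fun h : Lp ℝ 2 ν => ∫ y, h y ∂ν := by
    have : (fun h : Lp ℝ 2 ν => ∫ y, h y ∂ν) = fun h : Lp ℝ 2 ν =>
        inner ℝ (indicatorConstLp 2 MeasurableSet.univ (measure_ne_top ν univ) (1 : ℝ)) h := by
      funext h
      rw [L2.inner_indicatorConstLp_one, setIntegral_univ]
    rw [this]
    fun_prop
  have hPcont : Continuous P := by
    have h1 : (fun h : Lp ℝ 2 ν => ∫ y, max (h y) 0 ∂ν) = fun h => ∫ y, Lp.posPart h y ∂ν := by
      funext h
      exact integral_congr_ae (Lp.coeFn_posPart h).symm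
    have h2 : (fun h : Lp ℝ 2 ν => ∫ y, max (-h y) 0 ∂ν) = fun h => ∫ y, Lp.negPart h y ∂ν := by
      funext h
      refine integral_congr_ae ?_
      filter_upwards [Lp.coeFn_negPart_eq_max h] with y hy
      rw [hy]
    have h3 : Continuous fun h : Lp ℝ 2 ν => ∫ y, max (h y) 0 ∂ν := by
      rw [h1]; exact hIcont.comp Lp.continuous_posPart
    have h4 : Continuous fun h : Lp ℝ 2 ν => ∫ y, max (-h y) 0 ∂ν := by
      rw [h2]; exact hIcont.comp Lp.continuous_negPart
    exact (continuous_const.mul h3).add (continuous_const.mul h4)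
  have hPadd : ∀ h k : Lp ℝ 2 ν, P (h + k) ≤ P h + P k := by
    intro h k
    have h1 : ∫ y, max ((h + k : Lp ℝ 2 ν) y) 0 ∂ν
        ≤ ∫ y, max (h y) 0 ∂ν + ∫ y, max (k y) 0 ∂ν := by
      rw [← integral_add (hintp h) (hintp k)]
      refine integral_mono_ae (hintp _) ((hintp h).add (hintp k)) ?_
      filter_upwards [Lp.coeFn_add h k] with y hy
      rw [hy]
      simp only [Pi.add_apply]
      exact max_le (add_le_add (le_max_left _ _) (le_max_left _ _)) (by positivity)
    have h2 : ∫ y, max (-(h + k : Lp ℝ 2 ν) y) 0 ∂ν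
        ≤ ∫ y, max (-h y) 0 ∂ν + ∫ y, max (-k y) 0 ∂ν := by
      rw [← integral_add (hintn h) (hintn k)]
      refine integral_mono_ae (hintn _) ((hintn h).add (hintn k)) ?_
      filter_upwards [Lp.coeFn_add h k] with y hy
      rw [hy]
      simp only [Pi.add_apply, neg_add]
      exact max_le (add_le_add (le_max_left _ _) (le_max_left _ _)) (by positivity)
    have := mul_le_mul_of_nonneg_left h1 hCp
    have := mul_le_mul_of_nonneg_left h2 hCm
    simp only [hP]
    linarith
  have hPsmul : ∀ (t : ℝ) (h : Lp ℝ 2 ν), 0 ≤ t → P (t • h) = t * P h := by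
    intro t h ht
    have h1 : ∫ y, max ((t • h : Lp ℝ 2 ν) y) 0 ∂ν = t * ∫ y, max (h y) 0 ∂ν := by
      rw [← integral_const_mul]
      refine integral_congr_ae ?_
      filter_upwards [Lp.coeFn_smul t h] with y hy
      rw [hy, mul_max_of_nonneg _ _ ht]
      simp
    have h2 : ∫ y, max (-(t • h : Lp ℝ 2 ν) y) 0 ∂ν = t * ∫ y, max (-h y) 0 ∂ν := by
      rw [← integral_const_mul]
      refine integral_congr_ae ?_
      filter_upwards [Lp.coeFn_smul t h] with y hy
      rw [hy, mul_max_of_nonneg _ _ ht]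
      simp
    simp only [hP, h1, h2]
    ring
  have hP0 : P 0 = 0 := by simpa using hPsmul 0 0 le_rfl
  set T : Set (Lp ℝ 2 ν × ℝ) := {p | p.2 < V - P p.1} with hT
  have hTopen : IsOpen T := isOpen_lt continuous_snd (by fun_prop)
  have hTconv : Convex ℝ T := by
    intro p hp q hq a b ha hb hab
    simp only [hT, mem_ofPred_eq] at hp hq ⊢
    simp only [Prod.fst_add, Prod.snd_add, Prod.smul_fst, Prod.smul_snd, smul_eq_mul]
    have h1 := hPadd (a • p.1) (b • q.1)
    rw [hPsmul a _ ha, hPsmul b _ hb] at h1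
    have h2 : a * p.2 + b * q.2 < a * (V - P p.1) + b * (V - P q.1) := by
      rcases ha.eq_or_lt with rfl | ha'
      · have : b = 1 := by linarith
        subst this; linarith
      · have := mul_lt_mul_of_pos_left hp ha'
        have := mul_le_mul_of_nonneg_left hq.le hb
        linarith
    have h3 : a * V + b * V = V := by rw [← add_mul, hab, one_mul]
    nlinarith
  have hdisj : Disjoint T S := by
    rw [Set.disjoint_left]
    intro p hp hpS
    have h1 := hS p hpS
    simp only [hT, mem_ofPred_eq, hP] at hp
    linarith
  obtain ⟨φ, c, hφT, hφS⟩ := geometric_hahn_banach_open hTconv hTopen hSconv hdisj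
  set κ : ℝ := φ (0, 1) with hκ
  set ℓ : StrongDual ℝ (Lp ℝ 2 ν) := φ.comp (ContinuousLinearMap.inl ℝ _ ℝ) with hℓ
  have hφ : ∀ (h : Lp ℝ 2 ν) (r : ℝ), φ (h, r) = ℓ h + r * κ := by
    intro h r
    have : (h, r) = (h, 0) + r • ((0 : Lp ℝ 2 ν), (1 : ℝ)) := by simp
    rw [this, map_add, map_smul]
    simp [hℓ, hκ]
  have hκ0 : 0 ≤ κ := by
    by_contra! hneg
    set r : ℝ := min (V - 1) ((c + 1) / κ) with hr
    have h1 := hφT (0, r) (by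
      simp only [hT, mem_ofPred_eq, hP0]
      have := min_le_left (V - 1) ((c + 1) / κ)
      linarith)
    rw [hφ, map_zero, zero_add] at h1
    have h2 : (c + 1) / κ * κ ≤ r * κ :=
      mul_le_mul_of_nonpos_right (min_le_right _ _) hneg.le
    rw [div_mul_cancel₀ _ hneg.ne] at h2
    linarith
  have hκpos : 0 < κ := by
    refine hκ0.lt_of_ne fun h0 => ?_
    have hb : ∀ h : Lp ℝ 2 ν, ℓ h < c := fun h => by
      have := hφT (h, V - P h - 1) (by simp [hT])
      rw [hφ, ← h0, mul_zero, add_zero] at this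
      exact this
    obtain ⟨⟨h, r⟩, hp⟩ := hSne
    have h1 := hφS _ hp
    rw [hφ, ← h0, mul_zero, add_zero] at h1
    exact absurd (hb h) (not_lt.2 h1)
  have hkey : ∀ (h : Lp ℝ 2 ν), ℓ h + (V - P h) * κ ≤ c := by
    intro h
    refine le_of_forall_pos_lt_add fun ε hε => ?_
    have := hφT (h, V - P h - ε / κ) (by simp [hT, hε, hκpos])
    rw [hφ] at this
    have h2 : ε / κ * κ = ε := div_mul_cancel₀ _ hκpos.ne'
    nlinarith
  have hdom : ∀ h : Lp ℝ 2 ν, ℓ h ≤ κ * P h := by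
    intro h
    by_contra! hlt
    obtain ⟨n, hn⟩ := exists_nat_gt ((c - V * κ) / (ℓ h - κ * P h))
    rw [div_lt_iff₀ (by linarith)] at hn
    have := hkey ((n : ℝ) • h)
    rw [hPsmul _ _ n.cast_nonneg, map_smul, smul_eq_mul] at this
    nlinarith
  set g : Lp ℝ 2 ν := (InnerProductSpace.toDual ℝ _).symm ℓ with hg
  have hgl : ∀ h : Lp ℝ 2 ν, ℓ h = ∫ y, g y * h y ∂ν := by
    intro h
    rw [← InnerProductSpace.toDual_symm_apply, L2.inner_def]
    refine integral_congr_ae (Eventually.of_forall fun y => ?_)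
    simp [hg, mul_comm]
  have hgind : ∀ s : Set Ω, MeasurableSet s → ∀ a : ℝ,
      a * ∫ y in s, g y ∂ν ≤ κ * ((Cp * max a 0 + Cm * max (-a) 0) * ν.real s) := by
    intro s hs a
    have h0 := indicatorConstLp_coeFn (p := 2) (μ := ν) (hs := hs) (hμs := measure_ne_top ν s)
      (c := a)
    have h1 := hdom (indicatorConstLp 2 hs (measure_ne_top ν s) a)
    have e1 : ∫ y, g y * (indicatorConstLp 2 hs (measure_ne_top ν s) a : Lp ℝ 2 ν) y ∂ν
        = a * ∫ y in s, g y ∂ν := by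
      rw [← integral_const_mul, ← integral_indicator hs]
      refine integral_congr_ae ?_
      filter_upwards [h0] with y hy
      rw [hy]
      by_cases hys : y ∈ s <;> simp [hys, mul_comm]
    have e2 : ∫ y, max ((indicatorConstLp 2 hs (measure_ne_top ν s) a : Lp ℝ 2 ν) y) 0 ∂ν
        = max a 0 * ν.real s := by
      rw [mul_comm, ← smul_eq_mul, ← setIntegral_const, ← integral_indicator hs]
      refine integral_congr_ae ?_
      filter_upwards [h0] with y hy
      rw [hy]
      by_cases hys : y ∈ s <;> simp [hys]
    have e3 : ∫ y, max (-(indicatorConstLp 2 hs (measure_ne_top ν s) a : Lp ℝ 2 ν) y) 0 ∂ν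
        = max (-a) 0 * ν.real s := by
      rw [mul_comm, ← smul_eq_mul, ← setIntegral_const, ← integral_indicator hs]
      refine integral_congr_ae ?_
      filter_upwards [h0] with y hy
      rw [hy]
      by_cases hys : y ∈ s <;> simp [hys]
    rw [hgl, e1] at h1
    simp only [hP, e2, e3] at h1
    linarith
  have hub : ∀ᵐ y ∂ν, g y ≤ κ * Cp := by
    refine ae_le_of_forall_setIntegral_le (hint g) (integrable_const _) fun s hs _ => ?_
    have := hgind s hs 1
    rw [setIntegral_const, smul_eq_mul]
    norm_num at this
    linarith
  have hlb : ∀ᵐ y ∂ν, -(κ * Cm) ≤ g y := by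
    refine ae_le_of_forall_setIntegral_le (integrable_const _) (hint g) fun s hs _ => ?_
    have := hgind s hs (-1)
    rw [setIntegral_const, smul_eq_mul]
    norm_num at this
    linarith
  have hgm : Measurable (g : Ω → ℝ) := (Lp.stronglyMeasurable g).measurable
  refine ⟨fun y => max (-Cm) (min Cp (g y / κ)), ?_, fun y => ⟨le_max_left _ _, ?_⟩, ?_⟩
  · exact measurable_const.max (measurable_const.min (hgm.div_const κ))
  · exact max_le (by linarith) (min_le_left _ _)
  · rintro ⟨h, r⟩ hp
    have h1 := hφS _ hp
    have h2 := hkey 0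
    rw [map_zero, zero_add, hP0, sub_zero] at h2
    rw [hφ, hgl] at h1
    have h3 : ∫ y, max (-Cm) (min Cp (g y / κ)) * h y ∂ν = (∫ y, g y * h y ∂ν) / κ := by
      rw [← integral_div]
      refine integral_congr_ae ?_
      filter_upwards [hub, hlb] with y hy1 hy2
      rw [min_eq_right ((div_le_iff₀ hκpos).2 (by linarith)),
        max_eq_right ((le_div_iff₀ hκpos).2 (by linarith))]
      ring
    change V ≤ r + ∫ y, max (-Cm) (min Cp (g y / κ)) * h y ∂ν
    rw [h3, ← sub_le_iff_le_add', le_div_iff₀ hκpos]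
    linarith

section Densities

variable {α β : Type*} [MeasurableSpace α] [MeasurableSpace β]

/-- Bounded measurable nonnegative functions on a product, seen as densities of kernels. -/
structure IsDensity (ρ : α × β → ℝ) : Prop where
  meas : Measurable ρ
  nonneg : ∀ p, 0 ≤ ρ p
  bdd : ∃ B : ℝ, ∀ p, ρ p ≤ B

/-- A measurable weight with values between two positive constants. -/
structure IsWeight (F : α → β → ℝ) (a b : ℝ) : Prop where
  meas : Measurable fun p : α × β => F p.1 p.2
  pos : 0 < a
  lower : ∀ x y, a ≤ F x y
  upper : ∀ x y, F x y ≤ b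

/-- The quantity `∫ F(x,y) ρ(x,y) ν(dy)`. -/
def load (F : α → β → ℝ) (ν : Measure β) (ρ : α × β → ℝ) (x : α) : ℝ :=
  ∫ y, F x y * ρ (x, y) ∂ν

/-- The density of the second marginal of `ρ`. -/
def marginal (μ : Measure α) (ρ : α × β → ℝ) (y : β) : ℝ := ∫ x, ρ (x, y) ∂μ

/-- The cost of the kernel with density `ρ`. -/
def densityCost (F : α → β → ℝ) (G : ℝ → ℝ) (μ : Measure α) (ν : Measure β)
    (ρ : α × β → ℝ) : ℝ := ∫ x, G (load F ν ρ x) ∂μ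

/-- The infimum of the transport cost over kernels with a bounded density. -/
def densityValue (F : α → β → ℝ) (G : ℝ → ℝ) (μ : Measure α) (ν : Measure β) : ℝ :=
  sInf {r | ∃ ρ, IsDensity ρ ∧ (∀ᵐ y ∂ν, marginal μ ρ y = 1) ∧ densityCost F G μ ν ρ = r}

lemma integrable_of_measurable_of_abs_le {μ : Measure α} [IsFiniteMeasure μ] {f : α → ℝ}
    (hf : Measurable f) {C : ℝ} (hC : ∀ x, |f x| ≤ C) : Integrable f μ :=
  Integrable.of_bound hf.aestronglyMeasurable C (ae_of_all _ hC)

namespace IsDensity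

variable {ρ σ : α × β → ℝ}

lemma add (hρ : IsDensity ρ) (hσ : IsDensity σ) : IsDensity fun p => ρ p + σ p := by
  obtain ⟨B, hB⟩ := hρ.bdd
  obtain ⟨B', hB'⟩ := hσ.bdd
  exact ⟨hρ.meas.add hσ.meas, fun p => add_nonneg (hρ.nonneg p) (hσ.nonneg p),
    B + B', fun p => add_le_add (hB p) (hB' p)⟩

lemma const_mul (hρ : IsDensity ρ) {t : ℝ} (ht : 0 ≤ t) : IsDensity fun p => t * ρ p := by
  obtain ⟨B, hB⟩ := hρ.bdd
  exact ⟨hρ.meas.const_mul t, fun p => mul_nonneg ht (hρ.nonneg p),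
    t * B, fun p => mul_le_mul_of_nonneg_left (hB p) ht⟩

lemma of_snd {h : β → ℝ} (hm : Measurable h) (h0 : ∀ y, 0 ≤ h y) {B : ℝ} (hB : ∀ y, h y ≤ B) :
    IsDensity fun p : α × β => h p.2 :=
  ⟨hm.comp measurable_snd, fun p => h0 p.2, B, fun p => hB p.2⟩

lemma bdd_nonneg (hρ : IsDensity ρ) : ∃ B : ℝ, 0 ≤ B ∧ ∀ p, ρ p ≤ B := by
  obtain ⟨B, hB⟩ := hρ.bdd
  exact ⟨max B 0, le_max_right _ _, fun p => (hB p).trans (le_max_left _ _)⟩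

lemma integrable_mul (hρ : IsDensity ρ) {m : Measure (α × β)} [IsFiniteMeasure m]
    {f : α × β → ℝ} (hf : Measurable f) {C : ℝ} (hC : ∀ p, |f p| ≤ C) :
    Integrable (fun p => f p * ρ p) m := by
  obtain ⟨B, hB0, hB⟩ := hρ.bdd_nonneg
  refine integrable_of_measurable_of_abs_le (hf.mul hρ.meas) (C := C * B) fun p => ?_
  rw [abs_mul, abs_of_nonneg (hρ.nonneg p)]
  exact mul_le_mul (hC p) (hB p) (hρ.nonneg p) ((abs_nonneg _).trans (hC p))

lemma integrable_mul_right (hρ : IsDensity ρ) {ν : Measure β} [IsFiniteMeasure ν] (x : α)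
    {f : β → ℝ} (hf : Measurable f) {C : ℝ} (hC : ∀ y, |f y| ≤ C) :
    Integrable (fun y => f y * ρ (x, y)) ν := by
  obtain ⟨B, hB0, hB⟩ := hρ.bdd_nonneg
  refine integrable_of_measurable_of_abs_le (hf.mul (hρ.meas.comp measurable_prodMk_left))
    (C := C * B) fun y => ?_
  rw [abs_mul, abs_of_nonneg (hρ.nonneg _)]
  exact mul_le_mul (hC y) (hB _) (hρ.nonneg _) ((abs_nonneg _).trans (hC y))

lemma integrable_left (hρ : IsDensity ρ) {μ : Measure α} [IsFiniteMeasure μ] (y : β) :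
    Integrable (fun x => ρ (x, y)) μ := by
  obtain ⟨B, hB0, hB⟩ := hρ.bdd_nonneg
  refine integrable_of_measurable_of_abs_le (hρ.meas.comp measurable_prodMk_right)
    (C := B) fun x => ?_
  rw [abs_of_nonneg (hρ.nonneg _)]
  exact hB _

lemma integrable_right (hρ : IsDensity ρ) {ν : Measure β} [IsFiniteMeasure ν] (x : α) :
    Integrable (fun y => ρ (x, y)) ν := by
  simpa using hρ.integrable_mul_right (ν := ν) x (f := fun _ => 1) measurable_const
    (C := 1) (by simp)

lemma measurable_marginal (hρ : IsDensity ρ) (μ : Measure α) [SFinite μ] :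
    Measurable (marginal μ ρ) := by
  have : StronglyMeasurable fun p : β × α => ρ (p.2, p.1) :=
    (hρ.meas.comp measurable_swap).stronglyMeasurable
  exact (this.integral_prod_right (ν := μ)).measurable

lemma marginal_nonneg (hρ : IsDensity ρ) (μ : Measure α) (y : β) : 0 ≤ marginal μ ρ y :=
  integral_nonneg fun _ => hρ.nonneg _

lemma marginal_le {μ : Measure α} [IsProbabilityMeasure μ] (hρ : IsDensity ρ) {B : ℝ}
    (hB : ∀ p, ρ p ≤ B) (y : β) : marginal μ ρ y ≤ B := by
  calc marginal μ ρ y ≤ ∫ _, B ∂μ :=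
        integral_mono (hρ.integrable_left y) (integrable_const _) fun x => hB _
    _ = B := by simp

lemma integrable_marginal (hρ : IsDensity ρ) (μ : Measure α) [IsProbabilityMeasure μ]
    (ν : Measure β) [IsFiniteMeasure ν] : Integrable (marginal μ ρ) ν := by
  obtain ⟨B, -, hB⟩ := hρ.bdd_nonneg
  refine integrable_of_measurable_of_abs_le (hρ.measurable_marginal μ) (C := B) fun y => ?_
  rw [abs_of_nonneg (hρ.marginal_nonneg μ y)]
  exact hρ.marginal_le hB y

lemma marginal_add (hρ : IsDensity ρ) (hσ : IsDensity σ) (μ : Measure α) [IsFiniteMeasure μ]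
    (y : β) : marginal μ (fun p => ρ p + σ p) y = marginal μ ρ y + marginal μ σ y :=
  integral_add (hρ.integrable_left y) (hσ.integrable_left y)

end IsDensity

lemma marginal_const_mul {β : Type*} (μ : Measure α) (ρ : α × β → ℝ) (t : ℝ) (y : β) :
    marginal μ (fun p => t * ρ p) y = t * marginal μ ρ y :=
  integral_const_mul _ _

lemma marginal_of_snd {β : Type*} (μ : Measure α) [IsProbabilityMeasure μ] (h : β → ℝ) (y : β) :
    marginal μ (fun p : α × β => h p.2) y = h y := by
  simp [marginal]

namespace IsWeight

variable {F : α → β → ℝ} {a b : ℝ} {ρ σ : α × β → ℝ} {ν : Measure β}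

lemma nonneg (hF : IsWeight F a b) (x : α) (y : β) : 0 ≤ F x y := hF.pos.le.trans (hF.lower x y)

lemma abs_le (hF : IsWeight F a b) (x : α) (y : β) : |F x y| ≤ b := by
  rw [abs_of_nonneg (hF.nonneg x y)]
  exact hF.upper x y

lemma measurable_right (hF : IsWeight F a b) (x : α) : Measurable (F x) :=
  hF.meas.comp measurable_prodMk_left

lemma integrable_mul (hF : IsWeight F a b) (hρ : IsDensity ρ) [IsFiniteMeasure ν] (x : α) :
    Integrable (fun y => F x y * ρ (x, y)) ν :=
  hρ.integrable_mul_right x (hF.measurable_right x) (hF.abs_le x)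

lemma measurable_load (hF : IsWeight F a b) (hρ : IsDensity ρ) [SFinite ν] :
    Measurable (load F ν ρ) :=
  ((hF.meas.mul hρ.meas).stronglyMeasurable.integral_prod_right (ν := ν)).measurable

lemma load_nonneg (hF : IsWeight F a b) (hρ : IsDensity ρ) (x : α) : 0 ≤ load F ν ρ x :=
  integral_nonneg fun y => mul_nonneg (hF.nonneg x y) (hρ.nonneg _)

lemma load_le (hF : IsWeight F a b) (hρ : IsDensity ρ) [IsFiniteMeasure ν] (x : α) :
    load F ν ρ x ≤ b * ∫ y, ρ (x, y) ∂ν := by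
  rw [← integral_const_mul]
  exact integral_mono (hF.integrable_mul hρ x) ((hρ.integrable_right x).const_mul b)
    fun y => mul_le_mul_of_nonneg_right (hF.upper x y) (hρ.nonneg _)

lemma load_bdd (hF : IsWeight F a b) (hρ : IsDensity ρ) [IsProbabilityMeasure ν] :
    ∃ R : ℝ, ∀ x, load F ν ρ x ≤ R := by
  obtain ⟨B, hB0, hB⟩ := hρ.bdd_nonneg
  refine ⟨|b| * B, fun x => (hF.load_le hρ x).trans ?_⟩
  have h1 : ∫ y, ρ (x, y) ∂ν ≤ B := by
    calc _ ≤ ∫ _, B ∂ν := integral_mono (hρ.integrable_right x) (integrable_const _) fun y => hB _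
      _ = B := by simp
  exact mul_le_mul (le_abs_self b) h1 (integral_nonneg fun y => hρ.nonneg _) (abs_nonneg b)

lemma load_add (hF : IsWeight F a b) (hρ : IsDensity ρ) (hσ : IsDensity σ) [IsFiniteMeasure ν]
    (x : α) : load F ν (fun p => ρ p + σ p) x = load F ν ρ x + load F ν σ x := by
  simp only [load, mul_add]
  exact integral_add (hF.integrable_mul hρ x) (hF.integrable_mul hσ x)

lemma load_const_mul {α : Type*} (F : α → β → ℝ) (ν : Measure β) (ρ : α × β → ℝ) (t : ℝ) (x : α) :
    load F ν (fun p => t * ρ p) x = t * load F ν ρ x := by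
  simp only [load]
  rw [← integral_const_mul]
  exact integral_congr_ae (ae_of_all _ fun y => by ring)

lemma load_mono (hF : IsWeight F a b) (hρ : IsDensity ρ) (hσ : IsDensity σ) [IsFiniteMeasure ν]
    (h : ∀ p, ρ p ≤ σ p) (x : α) : load F ν ρ x ≤ load F ν σ x :=
  integral_mono (hF.integrable_mul hρ x) (hF.integrable_mul hσ x)
    fun y => mul_le_mul_of_nonneg_left (h _) (hF.nonneg x y)

lemma integral_load_le (hF : IsWeight F a b) (hρ : IsDensity ρ) (μ : Measure α)
    [IsProbabilityMeasure μ] [IsProbabilityMeasure ν] :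
    ∫ x, load F ν ρ x ∂μ ≤ b * ∫ y, marginal μ ρ y ∂ν := by
  obtain ⟨R, hR⟩ := hF.load_bdd (ν := ν) hρ
  have hint : Integrable ρ (μ.prod ν) := by
    simpa using hρ.integrable_mul (m := μ.prod ν) (f := fun _ => 1) measurable_const
      (C := 1) (by simp)
  have h1 : ∫ y, marginal μ ρ y ∂ν = ∫ x, ∫ y, ρ (x, y) ∂ν ∂μ :=
    (integral_integral_swap (f := fun x y => ρ (x, y)) hint).symm
  rw [h1, ← integral_const_mul]
  refine integral_mono (integrable_of_measurable_of_abs_le (hF.measurable_load hρ) (C := R)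
    fun x => ?_) (hint.integral_prod_left.const_mul b) fun x => hF.load_le hρ x
  rw [abs_of_nonneg (hF.load_nonneg hρ x)]
  exact hR x

end IsWeight

section ConvexCost

variable {G : ℝ → ℝ}

lemma measurable_comp_of_differentiableAt_pos (hG : ∀ u : ℝ, 0 < u → DifferentiableAt ℝ G u)
    {f : α → ℝ} (hf : Measurable f) (h0 : ∀ x, 0 ≤ f x) : Measurable fun x => G (f x) := by
  have hc : ContinuousOn G (Ioi 0) := fun u hu => (hG u hu).continuousAt.continuousWithinAt
  have hm : Measurable ((Ioi (0 : ℝ)).piecewise G fun _ => G 0) :=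
    hc.measurable_piecewise continuousOn_const measurableSet_Ioi
  convert hm.comp hf using 1
  funext x
  rcases (h0 x).eq_or_lt with h | h
  · simp [← h]
  · simp [h]

lemma exists_affine_le (hGc : ConvexOn ℝ (Ici 0) G)
    (hG : ∀ u : ℝ, 0 < u → DifferentiableAt ℝ G u) :
    ∃ c d : ℝ, 0 ≤ d ∧ ∀ u, 0 ≤ u → c - d * u ≤ G u := by
  have h1 : (1 : ℝ) ∈ Ici (0 : ℝ) := by simp
  have key : ∀ u, 0 ≤ u → G 1 + deriv G 1 * (u - 1) ≤ G u := by
    intro u hu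
    rcases lt_trichotomy u 1 with h | rfl | h
    · have := hGc.slope_le_deriv (x := u) hu h1 h (hG 1 one_pos)
      rw [slope_def_field, div_le_iff₀ (by linarith)] at this
      linarith
    · simp
    · have := hGc.deriv_le_slope (x := 1) h1 hu h (hG 1 one_pos)
      rw [slope_def_field, le_div_iff₀ (by linarith)] at this
      linarith
  refine ⟨G 1 - deriv G 1, |deriv G 1|, abs_nonneg _, fun u hu => ?_⟩
  have := key u hu
  have := mul_le_mul_of_nonneg_right (neg_abs_le (deriv G 1)) hu
  linarith

lemma abs_le_of_mem_Icc (hGc : ConvexOn ℝ (Ici 0) G)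
    (hG : ∀ u : ℝ, 0 < u → DifferentiableAt ℝ G u) (R : ℝ) :
    ∃ C, ∀ u, 0 ≤ u → u ≤ R → |G u| ≤ C := by
  obtain ⟨c, d, hd, h⟩ := exists_affine_le hGc hG
  refine ⟨max (max (G 0) (G R)) (-(c - d * R)), fun u hu huR => abs_le.2 ⟨?_, ?_⟩⟩
  · have h1 := h u hu
    have h2 := mul_le_mul_of_nonneg_left huR hd
    have := le_max_right (max (G 0) (G R)) (-(c - d * R))
    linarith
  · exact (hGc.le_max_of_mem_Icc (by simp) (hu.trans huR) ⟨hu, huR⟩).trans (le_max_left _ _)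

end ConvexCost

variable {F : α → β → ℝ} {a b : ℝ} {G : ℝ → ℝ} {ρ σ : α × β → ℝ} {μ : Measure α} {ν : Measure β}
  [IsProbabilityMeasure μ] [IsProbabilityMeasure ν]

lemma measurable_comp_load (hF : IsWeight F a b) (hG : ∀ u : ℝ, 0 < u → DifferentiableAt ℝ G u)
    (hρ : IsDensity ρ) : Measurable fun x => G (load F ν ρ x) :=
  measurable_comp_of_differentiableAt_pos hG (hF.measurable_load hρ) (hF.load_nonneg hρ)

lemma integrable_comp_load (hF : IsWeight F a b) (hGc : ConvexOn ℝ (Ici 0) G)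
    (hG : ∀ u : ℝ, 0 < u → DifferentiableAt ℝ G u) (hρ : IsDensity ρ) :
    Integrable (fun x => G (load F ν ρ x)) μ := by
  obtain ⟨R, hR⟩ := hF.load_bdd (ν := ν) hρ
  obtain ⟨C, hC⟩ := abs_le_of_mem_Icc hGc hG R
  exact integrable_of_measurable_of_abs_le (measurable_comp_load hF hG hρ)
    fun x => hC _ (hF.load_nonneg hρ x) (hR x)

lemma integrable_load (hF : IsWeight F a b) (hρ : IsDensity ρ) : Integrable (load F ν ρ) μ := by
  obtain ⟨R, hR⟩ := hF.load_bdd (ν := ν) hρ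
  refine integrable_of_measurable_of_abs_le (hF.measurable_load hρ) (C := R) fun x => ?_
  rw [abs_of_nonneg (hF.load_nonneg hρ x)]
  exact hR x

lemma densityCost_convex (hF : IsWeight F a b) (hGc : ConvexOn ℝ (Ici 0) G)
    (hG : ∀ u : ℝ, 0 < u → DifferentiableAt ℝ G u) (hρ : IsDensity ρ) (hσ : IsDensity σ)
    {s t : ℝ} (hs : 0 ≤ s) (ht : 0 ≤ t) (hst : s + t = 1) :
    densityCost F G μ ν (fun p => s * ρ p + t * σ p)
      ≤ s * densityCost F G μ ν ρ + t * densityCost F G μ ν σ := by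
  have i1 := (integrable_comp_load (μ := μ) (ν := ν) hF hGc hG hρ).const_mul s
  have i2 := (integrable_comp_load (μ := μ) (ν := ν) hF hGc hG hσ).const_mul t
  simp only [densityCost]
  rw [← integral_const_mul, ← integral_const_mul, ← integral_add i1 i2]
  refine integral_mono (integrable_comp_load hF hGc hG ((hρ.const_mul hs).add (hσ.const_mul ht)))
    (i1.add i2) fun x => ?_
  simp only [hF.load_add (hρ.const_mul hs) (hσ.const_mul ht), IsWeight.load_const_mul]
  exact hGc.2 (hF.load_nonneg hρ x) (hF.load_nonneg hσ x) hs ht hst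

lemma densityCost_of_snd_le (hF : IsWeight F a b) (hGc : ConvexOn ℝ (Ici 0) G)
    (hG : ∀ u : ℝ, 0 < u → DifferentiableAt ℝ G u) {h : β → ℝ}
    (hd : IsDensity fun p : α × β => h p.2) {R : ℝ} (hR : b * ∫ y, h y ∂ν ≤ R) :
    densityCost F G μ ν (fun p => h p.2) ≤ max (G 0) (G R) := by
  calc densityCost F G μ ν (fun p => h p.2) ≤ ∫ _, max (G 0) (G R) ∂μ := by
        refine integral_mono (integrable_comp_load hF hGc hG hd) (integrable_const _) fun x => ?_
        have h0 := hF.load_nonneg (ν := ν) hd x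
        have h1 := (hF.load_le (ν := ν) hd x).trans hR
        exact hGc.le_max_of_mem_Icc (by simp) (h0.trans h1) ⟨h0, h1⟩
    _ = _ := by simp

lemma exists_le_densityCost (hF : IsWeight F a b) (hGc : ConvexOn ℝ (Ici 0) G)
    (hG : ∀ u : ℝ, 0 < u → DifferentiableAt ℝ G u) :
    ∃ K : ℝ, ∀ ρ : α × β → ℝ, IsDensity ρ → (∀ᵐ y ∂ν, marginal μ ρ y = 1) →
      K ≤ densityCost F G μ ν ρ := by
  obtain ⟨c, d, hd, h⟩ := exists_affine_le hGc hG
  refine ⟨c - d * b, fun ρ hρ hmarg => ?_⟩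
  have h1 : ∫ y, marginal μ ρ y ∂ν = 1 := by simp [integral_congr_ae hmarg]
  have h2 := hF.integral_load_le (ν := ν) hρ μ
  rw [h1, mul_one] at h2
  have i1 := (integrable_load (μ := μ) (ν := ν) hF hρ).const_mul d
  calc c - d * b ≤ c - d * ∫ x, load F ν ρ x ∂μ := by
        have := mul_le_mul_of_nonneg_left h2 hd
        linarith
    _ = ∫ x, (c - d * load F ν ρ x) ∂μ := by
        rw [integral_sub (integrable_const c) i1, integral_const_mul]
        simp
    _ ≤ _ := integral_mono ((integrable_const c).sub i1) (integrable_comp_load hF hGc hG hρ)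
        fun x => h _ (hF.load_nonneg hρ x)

lemma densityValue_le (hF : IsWeight F a b) (hGc : ConvexOn ℝ (Ici 0) G)
    (hG : ∀ u : ℝ, 0 < u → DifferentiableAt ℝ G u) (hρ : IsDensity ρ)
    (hmarg : ∀ᵐ y ∂ν, marginal μ ρ y = 1) :
    densityValue F G μ ν ≤ densityCost F G μ ν ρ := by
  obtain ⟨K, hK⟩ := exists_le_densityCost (μ := μ) (ν := ν) hF hGc hG
  refine csInf_le ⟨K, ?_⟩ ⟨ρ, hρ, hmarg, rfl⟩
  rintro r ⟨σ, hσ, hσm, rfl⟩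
  exact hK σ hσ hσm

lemma IsDensity.snd_mul (hρ : IsDensity ρ) {w : β → ℝ} (hw : Measurable w) (h0 : ∀ y, 0 ≤ w y)
    (h1 : ∀ y, w y ≤ 1) : IsDensity fun p => w p.2 * ρ p := by
  obtain ⟨B, hB⟩ := hρ.bdd
  exact ⟨(hw.comp measurable_snd).mul hρ.meas, fun p => mul_nonneg (h0 _) (hρ.nonneg p), B,
    fun p => (mul_le_of_le_one_left (hρ.nonneg p) (h1 _)).trans (hB p)⟩

lemma densityValue_le_of_snd (hF : IsWeight F a b) (hb : 0 ≤ b) (hGc : ConvexOn ℝ (Ici 0) G)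
    (hG : ∀ u : ℝ, 0 < u → DifferentiableAt ℝ G u) :
    densityValue F G μ ν ≤ max (G 0) (G (2 * b)) := by
  have hd : IsDensity fun p : α × β => (fun _ : β => (1 : ℝ)) p.2 :=
    IsDensity.of_snd measurable_const (by simp) (B := 1) (by simp)
  refine (densityValue_le hF hGc hG hd (ae_of_all _ fun y => ?_)).trans
    (densityCost_of_snd_le (h := fun _ => 1) hF hGc hG hd ?_)
  · simp [marginal]
  · simp only [integral_const, probReal_univ, smul_eq_mul]
    linarith

/-- Exact penalisation of an excess of mass when the slopes of `G` are bounded below. -/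
lemma densityValue_le_of_one_le_marginal (hF : IsWeight F a b) (hGc : ConvexOn ℝ (Ici 0) G)
    (hG : ∀ u : ℝ, 0 < u → DifferentiableAt ℝ G u) {C : ℝ} (hC : 0 ≤ C)
    (hslope : ∀ u v : ℝ, 0 < u → u ≤ v → G u ≤ G v + C * (v - u))
    (hρ : IsDensity ρ) (hmarg : ∀ᵐ y ∂ν, 1 ≤ marginal μ ρ y) :
    densityValue F G μ ν ≤ densityCost F G μ ν ρ + C * b * ∫ y, (marginal μ ρ y - 1) ∂ν := by
  obtain ⟨B, hB0, hB⟩ := hρ.bdd_nonneg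
  have hη : ∀ y, 0 < max (marginal μ ρ y) 1 := fun y => lt_max_of_lt_right one_pos
  set w : β → ℝ := fun y => (max (marginal μ ρ y) 1)⁻¹ with hw
  have hwm : Measurable w := ((hρ.measurable_marginal μ).max measurable_const).inv
  have hw0 : ∀ y, 0 ≤ w y := fun y => (inv_pos.2 (hη y)).le
  have hw1 : ∀ y, w y ≤ 1 := fun y => inv_le_one_of_one_le₀ (le_max_right _ _)
  have hwB : ∀ y, 1 ≤ max B 1 * w y := fun y => by
    rw [hw, ← div_eq_mul_inv, one_le_div (hη y)]
    exact max_le_max_right 1 (hρ.marginal_le hB y)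
  have hρ' : IsDensity fun p => w p.2 * ρ p := hρ.snd_mul hwm hw0 hw1
  have hτ : IsDensity fun p => (1 - w p.2) * ρ p :=
    hρ.snd_mul (w := fun y => 1 - w y) (measurable_const.sub hwm) (fun y => sub_nonneg.2 (hw1 y))
      fun y => sub_le_self _ (hw0 y)
  have hsum : ∀ x, load F ν ρ x
      = load F ν (fun p => w p.2 * ρ p) x + load F ν (fun p => (1 - w p.2) * ρ p) x := by
    intro x
    rw [← hF.load_add hρ' hτ]
    congr 1
    funext p
    ring
  have hle : ∀ x, G (load F ν (fun p => w p.2 * ρ p) x)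
      ≤ G (load F ν ρ x) + C * load F ν (fun p => (1 - w p.2) * ρ p) x := by
    intro x
    have h0 := hF.load_nonneg (ν := ν) hρ' x
    have hτ0 := hF.load_nonneg (ν := ν) hτ x
    rcases h0.eq_or_lt with h | h
    · have h1 : load F ν ρ x ≤ max B 1 * load F ν (fun p => w p.2 * ρ p) x := by
        rw [← IsWeight.load_const_mul]
        refine hF.load_mono hρ (hρ'.const_mul (by positivity)) (fun p => ?_) x
        have := mul_le_mul_of_nonneg_right (hwB p.2) (hρ.nonneg p)
        linarith
      rw [← h, mul_zero] at h1
      have h2 : load F ν ρ x = 0 := h1.antisymm (hF.load_nonneg hρ x)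
      rw [← h, h2]
      have := mul_nonneg hC hτ0
      linarith
    · have := hslope _ (load F ν ρ x) h (by rw [hsum]; linarith)
      have h3 := hsum x
      have h4 : load F ν ρ x - load F ν (fun p => w p.2 * ρ p) x
        = load F ν (fun p => (1 - w p.2) * ρ p) x := by linarith
      rwa [h4] at this
  have hm' : ∀ᵐ y ∂ν, marginal μ (fun p => w p.2 * ρ p) y = 1 := by
    filter_upwards [hmarg] with y hy
    have : marginal μ (fun p => w p.2 * ρ p) y = w y * marginal μ ρ y := by
      simp only [marginal]
      exact integral_const_mul _ _
    rw [this, hw]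
    simp only [max_eq_left hy]
    exact inv_mul_cancel₀ (by linarith)
  have hmτ : ∫ y, marginal μ (fun p => (1 - w p.2) * ρ p) y ∂ν
      = ∫ y, (marginal μ ρ y - 1) ∂ν := by
    refine integral_congr_ae ?_
    filter_upwards [hm'] with y hy
    have h1 := hρ'.marginal_add hτ μ y
    have h2 : (fun p : α × β => w p.2 * ρ p + (1 - w p.2) * ρ p) = ρ := by funext p; ring
    rw [h2, hy] at h1
    linarith
  have i1 := integrable_comp_load (μ := μ) (ν := ν) hF hGc hG hρ
  have i2 := (integrable_load (μ := μ) (ν := ν) hF hτ).const_mul C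
  calc densityValue F G μ ν ≤ densityCost F G μ ν (fun p => w p.2 * ρ p) :=
        densityValue_le hF hGc hG hρ' hm'
    _ ≤ ∫ x, (G (load F ν ρ x) + C * load F ν (fun p => (1 - w p.2) * ρ p) x) ∂μ :=
        integral_mono (integrable_comp_load hF hGc hG hρ') (i1.add i2) hle
    _ = densityCost F G μ ν ρ + C * ∫ x, load F ν (fun p => (1 - w p.2) * ρ p) x ∂μ := by
        rw [integral_add i1 i2, integral_const_mul, densityCost]
    _ ≤ _ := by
        have := hF.integral_load_le (ν := ν) hτ μ
        rw [hmτ] at this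
        have := mul_le_mul_of_nonneg_left this hC
        linarith

/-- Exact penalisation of an excess of mass when the target space is finite. -/
lemma exists_densityValue_le_of_finite [Finite β] [MeasurableSingletonClass β]
    (hF : IsWeight F a b) (hb : 0 ≤ b) (hGc : ConvexOn ℝ (Ici 0) G)
    (hG : ∀ u : ℝ, 0 < u → DifferentiableAt ℝ G u) :
    ∃ C : ℝ, 0 ≤ C ∧ ∀ ρ : α × β → ℝ, IsDensity ρ → (∀ᵐ y ∂ν, 1 ≤ marginal μ ρ y) →
      densityValue F G μ ν ≤ densityCost F G μ ν ρ + C * ∫ y, (marginal μ ρ y - 1) ∂ν := by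
  set V := densityValue F G μ ν with hV
  set M := max (G 0) (G (2 * b)) with hM
  have hVM : V ≤ M := densityValue_le_of_snd hF hb hGc hG
  obtain ⟨q, hq, hqν⟩ : ∃ q : ℝ, 0 < q ∧ ∀ y, ν {y} ≠ 0 → q ≤ ν.real {y} := by
    have hfin : ({y | ν {y} ≠ 0} : Set β).Finite := Set.toFinite _
    have hne : ({y | ν {y} ≠ 0} : Set β).Nonempty := by
      by_contra! hemp
      have : ∀ᵐ y ∂ν, False := by
        rw [ae_iff_of_countable]
        intro y hy
        exact (hemp ▸ (show y ∈ {y | ν {y} ≠ 0} from hy) : y ∈ (∅ : Set β))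
      exact absurd this (by simpa using IsProbabilityMeasure.ne_zero ν)
    obtain ⟨y₀, hy₀, hmin⟩ := hfin.exists_minimalFor (fun y => ν.real {y}) _ hne
    refine ⟨ν.real {y₀}, ENNReal.toReal_pos hy₀ (measure_ne_top _ _), fun y hy => ?_⟩
    by_contra! hlt
    exact absurd (hmin hy hlt.le) (not_le.2 hlt)
  refine ⟨(M - V) / q, div_nonneg (sub_nonneg.2 hVM) hq.le, fun ρ hρ hmarg => ?_⟩
  set s : β → ℝ := fun y => marginal μ ρ y - 1 with hs
  have hsm : Measurable s := (hρ.measurable_marginal μ).sub measurable_const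
  have hsi : Integrable s ν := (hρ.integrable_marginal μ ν).sub (integrable_const 1)
  have hs0 : 0 ≤ᵐ[ν] s := by
    filter_upwards [hmarg] with y hy
    simpa [hs] using hy
  set σ : ℝ := (∫ y, s y ∂ν) / q with hσ
  have hσ0 : 0 ≤ σ := div_nonneg (integral_nonneg_of_ae hs0) hq.le
  have hsσ : ∀ᵐ y ∂ν, s y ≤ σ := by
    rw [ae_iff_of_countable]
    intro y hy
    have h0 : 0 ≤ s y := by
      rw [EventuallyLE, ae_iff_of_countable] at hs0
      exact hs0 y hy
    have h1 := setIntegral_le_integral (s := {y}) hsi hs0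
    rw [integral_singleton, smul_eq_mul] at h1
    rw [hσ, le_div_iff₀ hq]
    nlinarith [mul_le_mul_of_nonneg_right (hqν y hy) h0]
  have hfinal : V ≤ densityCost F G μ ν ρ + σ * (M - V) := by
    rcases hσ0.eq_or_lt with h | h
    · rw [← h, zero_mul, add_zero]
      refine densityValue_le hF hGc hG hρ ?_
      filter_upwards [hs0, hsσ] with y hy1 hy2
      simp only [Pi.zero_apply, hs] at hy1 hy2
      linarith
    · set k : β → ℝ := fun y => max 0 (min 1 (1 - s y / σ)) with hk
      have hkm : Measurable k :=
        measurable_const.max (measurable_const.min (measurable_const.sub (hsm.div_const σ)))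
      have hk0 : ∀ y, 0 ≤ k y := fun y => le_max_left _ _
      have hk1 : ∀ y, k y ≤ 1 := fun y => max_le zero_le_one (min_le_left _ _)
      have hkd : IsDensity fun p : α × β => k p.2 := IsDensity.of_snd hkm hk0 hk1
      have hkI : ∫ y, k y ∂ν ≤ 1 := by
        calc ∫ y, k y ∂ν ≤ ∫ _, 1 ∂ν := integral_mono (integrable_of_measurable_of_abs_le hkm
              (C := 1) fun y => by rw [abs_of_nonneg (hk0 y)]; exact hk1 y) (integrable_const _) hk1
          _ = 1 := by simp
      have hkae : ∀ᵐ y ∂ν, k y = 1 - s y / σ := by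
        filter_upwards [hs0, hsσ] with y hy1 hy2
        have e1 : 0 ≤ s y / σ := div_nonneg hy1 h.le
        have e2 : s y / σ ≤ 1 := (div_le_one h).2 hy2
        simp only [hk]
        rw [min_eq_right (by linarith), max_eq_right (by linarith)]
      have h1σ : 0 < 1 + σ := by linarith
      have hst : 1 / (1 + σ) + σ / (1 + σ) = 1 := by field_simp
      have hd1 := hρ.const_mul (t := 1 / (1 + σ)) (by positivity)
      have hd2 := hkd.const_mul (t := σ / (1 + σ)) (by positivity)
      have h1 := densityValue_le (μ := μ) (ν := ν) hF hGc hG (hd1.add hd2) (by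
        filter_upwards [hkae] with y hy
        rw [hd1.marginal_add hd2, marginal_const_mul, marginal_const_mul, marginal_of_snd, hy]
        simp only [hs]
        field_simp
        ring)
      have h2 := densityCost_convex (μ := μ) (ν := ν) hF hGc hG hρ hkd
        (s := 1 / (1 + σ)) (t := σ / (1 + σ)) (by positivity) (by positivity) hst
      have h3 : densityCost F G μ ν (fun p : α × β => k p.2) ≤ M :=
        densityCost_of_snd_le hF hGc hG hkd (by nlinarith)
      have h4 : V ≤ 1 / (1 + σ) * densityCost F G μ ν ρ + σ / (1 + σ) * M :=
        (h1.trans h2).trans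
          (add_le_add_right (mul_le_mul_of_nonneg_left h3 (by positivity)) _)
      have h5 : 1 / (1 + σ) * densityCost F G μ ν ρ + σ / (1 + σ) * M
          = (densityCost F G μ ν ρ + σ * M) / (1 + σ) := by ring
      rw [h5, le_div_iff₀ h1σ] at h4
      linarith
  have : σ * (M - V) = (M - V) / q * ∫ y, s y ∂ν := by rw [hσ]; ring
  rw [← this]
  exact hfinal

/-- Exact penalisation of a lack of mass. -/
lemma densityValue_le_penalty (hF : IsWeight F a b) (hGc : ConvexOn ℝ (Ici 0) G)
    (hG : ∀ u : ℝ, 0 < u → DifferentiableAt ℝ G u) {C : ℝ}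
    (hC : ∀ ρ : α × β → ℝ, IsDensity ρ → (∀ᵐ y ∂ν, 1 ≤ marginal μ ρ y) →
      densityValue F G μ ν ≤ densityCost F G μ ν ρ + C * ∫ y, (marginal μ ρ y - 1) ∂ν)
    (hρ : IsDensity ρ) :
    densityValue F G μ ν ≤ densityCost F G μ ν ρ +
      (C * ∫ y, max (marginal μ ρ y - 1) 0 ∂ν +
        (max (G 0) (G (2 * b)) - densityValue F G μ ν) *
          ∫ y, max (-(marginal μ ρ y - 1)) 0 ∂ν) := by
  set V := densityValue F G μ ν with hV
  set M := max (G 0) (G (2 * b)) with hM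
  set s : β → ℝ := fun y => marginal μ ρ y - 1 with hs
  have hsm : Measurable s := (hρ.measurable_marginal μ).sub measurable_const
  have hsi : Integrable s ν := (hρ.integrable_marginal μ ν).sub (integrable_const 1)
  have hs1 : ∀ y, -1 ≤ s y := fun y => by
    have := hρ.marginal_nonneg μ y
    simp only [hs]
    linarith
  set n : β → ℝ := fun y => max (-s y) 0 with hn
  have hnm : Measurable n := hsm.neg.max measurable_const
  have hn0 : ∀ y, 0 ≤ n y := fun y => le_max_right _ _
  have hn1 : ∀ y, n y ≤ 1 := fun y => max_le (by linarith [hs1 y]) zero_le_one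
  have hni : Integrable n ν := hsi.neg_part
  have hsn : ∀ y, s y + n y = max (s y) 0 := fun y => by
    rcases le_total (s y) 0 with h | h
    · simp [hn, h]
    · simp [hn, h]
  set δ : ℝ := ∫ y, n y ∂ν with hδ
  change V ≤ densityCost F G μ ν ρ + (C * ∫ y, max (s y) 0 ∂ν + (M - V) * δ)
  rcases (integral_nonneg hn0 : 0 ≤ δ).eq_or_lt with h | h
  · have hn_ae : ∀ᵐ y ∂ν, n y = 0 := by
      have := (integral_eq_zero_iff_of_nonneg hn0 hni).1 h.symm
      filter_upwards [this] with y hy using hy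
    have h1 := hC ρ hρ (by
      filter_upwards [hn_ae] with y hy
      have h2 := hsn y
      rw [hy, add_zero] at h2
      have : 0 ≤ s y := h2 ▸ le_max_right _ _
      simp only [hs] at this
      linarith)
    have h2 : ∫ y, max (s y) 0 ∂ν = ∫ y, s y ∂ν := by
      refine integral_congr_ae ?_
      filter_upwards [hn_ae] with y hy
      rw [← hsn, hy, add_zero]
    have hδ0 : δ = 0 := h.symm
    rw [h2, hδ0, mul_zero, add_zero]
    exact h1
  · set k : β → ℝ := fun y => 1 + n y / δ with hk
    have hkm : Measurable k := measurable_const.add (hnm.div_const δ)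
    have hkd : IsDensity fun p : α × β => k p.2 :=
      IsDensity.of_snd hkm (fun y => add_nonneg zero_le_one (div_nonneg (hn0 y) h.le))
        (B := 1 + 1 / δ) fun y => by simp only [hk]; gcongr; exact hn1 y
    have hkI : ∫ y, k y ∂ν = 2 := by
      simp only [hk]
      rw [integral_add (integrable_const _) (hni.div_const δ), integral_div, ← hδ,
        div_self h.ne']
      norm_num
    have h1δ : 0 < 1 + δ := by linarith
    have hst : 1 / (1 + δ) + δ / (1 + δ) = 1 := by field_simp
    have hd1 := hρ.const_mul (t := 1 / (1 + δ)) (by positivity)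
    have hd2 := hkd.const_mul (t := δ / (1 + δ)) (by positivity)
    have hmarg : ∀ y, marginal μ (fun p => 1 / (1 + δ) * ρ p + δ / (1 + δ) * k p.2) y - 1
        = 1 / (1 + δ) * max (s y) 0 := by
      intro y
      rw [hd1.marginal_add hd2, marginal_const_mul, marginal_const_mul, marginal_of_snd, ← hsn]
      have hδne : δ ≠ 0 := h.ne'
      have hnk : δ * k y = δ + n y := by
        simp only [hk]
        field_simp
      have : marginal μ ρ y = s y + 1 := by simp [hs]
      rw [this, div_mul_eq_mul_div, div_mul_eq_mul_div, div_mul_eq_mul_div, hnk]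
      field_simp
      ring
    have h1 := hC _ (hd1.add hd2) (ae_of_all _ fun y => by
      have h2 := hmarg y
      have h3 : 0 ≤ 1 / (1 + δ) * max (s y) 0 := by positivity
      linarith)
    simp only [hmarg] at h1
    rw [integral_const_mul] at h1
    have h2 := densityCost_convex (μ := μ) (ν := ν) hF hGc hG hρ hkd
      (s := 1 / (1 + δ)) (t := δ / (1 + δ)) (by positivity) (by positivity) hst
    have h3 : densityCost F G μ ν (fun p : α × β => k p.2) ≤ M :=
      densityCost_of_snd_le hF hGc hG hkd (by rw [hkI, mul_comm])
    have h4 : V ≤ 1 / (1 + δ) * densityCost F G μ ν ρ + δ / (1 + δ) * M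
        + C * (1 / (1 + δ) * ∫ y, max (s y) 0 ∂ν) := by
      refine h1.trans (add_le_add_left (h2.trans ?_) _)
      exact add_le_add_right (mul_le_mul_of_nonneg_left h3 (by positivity)) _
    have h5 : 1 / (1 + δ) * densityCost F G μ ν ρ + δ / (1 + δ) * M
        + C * (1 / (1 + δ) * ∫ y, max (s y) 0 ∂ν)
        = (densityCost F G μ ν ρ + δ * M + C * ∫ y, max (s y) 0 ∂ν) / (1 + δ) := by ring
    rw [h5, le_div_iff₀ h1δ] at h4
    linarith

lemma densityValue_le_penalty_of_antitone (hF : IsWeight F a b) (hGc : ConvexOn ℝ (Ici 0) G)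
    (hG : ∀ u : ℝ, 0 < u → DifferentiableAt ℝ G u) (hanti : AntitoneOn G (Ici 0)) {C : ℝ}
    (hC : ∀ ρ : α × β → ℝ, IsDensity ρ → (∀ᵐ y ∂ν, 1 ≤ marginal μ ρ y) →
      densityValue F G μ ν ≤ densityCost F G μ ν ρ + C * ∫ y, (marginal μ ρ y - 1) ∂ν)
    (hρ : IsDensity ρ) :
    densityValue F G μ ν ≤ densityCost F G μ ν ρ + C * ∫ y, max (marginal μ ρ y - 1) 0 ∂ν := by
  set n : β → ℝ := fun y => max (1 - marginal μ ρ y) 0 with hn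
  have hnd : IsDensity fun p : α × β => n p.2 :=
    IsDensity.of_snd ((measurable_const.sub (hρ.measurable_marginal μ)).max measurable_const)
      (fun y => le_max_right _ _) (B := 1)
      fun y => max_le (by linarith [hρ.marginal_nonneg μ y]) zero_le_one
  have hmarg : ∀ y, marginal μ (fun p => ρ p + n p.2) y - 1 = max (marginal μ ρ y - 1) 0 := by
    intro y
    rw [hρ.marginal_add hnd, marginal_of_snd]
    simp only [hn]
    rcases le_total (marginal μ ρ y) 1 with h | h
    · rw [max_eq_left (by linarith), max_eq_right (by linarith)]; ring
    · rw [max_eq_right (by linarith), max_eq_left (by linarith)]; ring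
  have h1 := hC _ (hρ.add hnd) (ae_of_all _ fun y => by
    have := hmarg y
    linarith [le_max_right (marginal μ ρ y - 1) 0])
  simp only [hmarg] at h1
  refine h1.trans (add_le_add_left ?_ _)
  refine integral_mono (integrable_comp_load hF hGc hG (hρ.add hnd))
    (integrable_comp_load hF hGc hG hρ) fun x => ?_
  exact hanti (hF.load_nonneg hρ x) (hF.load_nonneg (hρ.add hnd) x)
    (hF.load_mono hρ (hρ.add hnd) (fun p => le_add_of_nonneg_right (hnd.nonneg p)) x)

lemma le_add_abs_mul_sub_of_tendsto_deriv (hGc : ConvexOn ℝ (Ici 0) G)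
    (hG : ∀ u : ℝ, 0 < u → DifferentiableAt ℝ G u) {l : ℝ}
    (hl : Tendsto (deriv G) (𝓝[>] (0 : ℝ)) (𝓝 l)) {u v : ℝ} (hu : 0 < u) (huv : u ≤ v) :
    G u ≤ G v + |l| * (v - u) := by
  rcases huv.eq_or_lt with rfl | huv
  · simp
  have hmono : MonotoneOn (deriv G) (Ioi 0) :=
    (hGc.subset Ioi_subset_Ici_self (convex_Ioi 0)).monotoneOn_deriv fun x hx => hG x hx
  have h1 : l ≤ deriv G u := by
    refine le_of_tendsto hl ?_
    filter_upwards [Ioo_mem_nhdsGT hu] with x hx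
    exact hmono hx.1 hu hx.2.le
  have h2 := hGc.deriv_le_slope (x := u) (y := v) hu.le (hu.trans huv).le huv (hG u hu)
  rw [slope_def_field, le_div_iff₀ (by linarith)] at h2
  have h3 := mul_le_mul_of_nonneg_right ((neg_abs_le l).trans h1) (sub_nonneg.2 huv.le)
  linarith

/-- Exact penalisation of the marginal constraint, with vanishing constants in the monotone
cases. -/
lemma exists_penalty [MeasurableSingletonClass β] (hF : IsWeight F a b) (hb : 0 ≤ b)
    (hGc : ConvexOn ℝ (Ici 0) G) (hG : ∀ u : ℝ, 0 < u → DifferentiableAt ℝ G u)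
    (hG0 : (∃ l : ℝ, Tendsto (deriv G) (𝓝[>] (0 : ℝ)) (𝓝 l)) ∨ Finite β) :
    ∃ Cp Cm : ℝ, 0 ≤ Cp ∧ 0 ≤ Cm ∧ (MonotoneOn G (Ici 0) → Cp = 0) ∧
      (AntitoneOn G (Ici 0) → Cm = 0) ∧ ∀ ρ : α × β → ℝ, IsDensity ρ →
        densityValue F G μ ν ≤ densityCost F G μ ν ρ +
          (Cp * ∫ y, max (marginal μ ρ y - 1) 0 ∂ν +
            Cm * ∫ y, max (-(marginal μ ρ y - 1)) 0 ∂ν) := by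
  obtain ⟨Cp, hCp, hmono, hC⟩ : ∃ Cp : ℝ, 0 ≤ Cp ∧ (MonotoneOn G (Ici 0) → Cp = 0) ∧
      ∀ ρ : α × β → ℝ, IsDensity ρ → (∀ᵐ y ∂ν, 1 ≤ marginal μ ρ y) →
        densityValue F G μ ν ≤ densityCost F G μ ν ρ + Cp * ∫ y, (marginal μ ρ y - 1) ∂ν := by
    by_cases hm : MonotoneOn G (Ici 0)
    · refine ⟨0, le_rfl, fun _ => rfl, fun ρ hρ hmarg => ?_⟩
      have := densityValue_le_of_one_le_marginal hF hGc hG le_rfl (fun u v hu huv => by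
        simpa using hm hu.le (hu.le.trans huv) huv) hρ hmarg
      simpa using this
    · rcases hG0 with ⟨l, hl⟩ | hfin
      · exact ⟨|l| * b, by positivity, fun h => absurd h hm, fun ρ hρ hmarg =>
          densityValue_le_of_one_le_marginal hF hGc hG (abs_nonneg l)
            (fun u v hu huv => le_add_abs_mul_sub_of_tendsto_deriv hGc hG hl hu huv) hρ hmarg⟩
      · obtain ⟨C, hC0, hC⟩ :=
          exists_densityValue_le_of_finite (μ := μ) (ν := ν) hF hb hGc hG
        exact ⟨C, hC0, fun h => absurd h hm, hC⟩
  by_cases ha : AntitoneOn G (Ici 0)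
  · refine ⟨Cp, 0, hCp, le_rfl, hmono, fun _ => rfl, fun ρ hρ => ?_⟩
    rw [zero_mul, add_zero]
    exact densityValue_le_penalty_of_antitone hF hGc hG ha hC hρ
  · exact ⟨Cp, _, hCp, sub_nonneg.2 (densityValue_le_of_snd hF hb hGc hG), hmono,
      fun h => absurd h ha, fun ρ hρ => densityValue_le_penalty hF hGc hG hC hρ⟩

lemma measurable_load_of_measurable {f : β → ℝ} (hf : Measurable f) (hρ : IsDensity ρ) :
    Measurable (load (fun _ : α => f) ν ρ) :=
  (((hf.comp measurable_snd).mul hρ.meas).stronglyMeasurable.integral_prod_right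
    (ν := ν)).measurable

lemma integrable_load_of_bounded {f : β → ℝ} (hf : Measurable f) {C : ℝ} (hC : ∀ y, |f y| ≤ C)
    (hρ : IsDensity ρ) : Integrable (load (fun _ : α => f) ν ρ) μ :=
  (hρ.integrable_mul (m := μ.prod ν) (f := fun p => f p.2) (hf.comp measurable_snd)
    fun p => hC p.2).integral_prod_left

lemma integral_load_eq {f : β → ℝ} (hf : Measurable f) {C : ℝ} (hC : ∀ y, |f y| ≤ C)
    (hρ : IsDensity ρ) :
    ∫ x, load (fun _ : α => f) ν ρ x ∂μ = ∫ y, f y * marginal μ ρ y ∂ν := by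
  have h := integral_integral_swap (f := fun x y => f y * ρ (x, y))
    (hρ.integrable_mul (m := μ.prod ν) (f := fun p => f p.2) (hf.comp measurable_snd)
      fun p => hC p.2)
  simp only [load, h, marginal, integral_const_mul]

/-- Lagrange multiplier for the marginal constraint. -/
lemma exists_multiplier [MeasurableSingletonClass β] (hF : IsWeight F a b) (hb : 0 ≤ b)
    (hGc : ConvexOn ℝ (Ici 0) G) (hG : ∀ u : ℝ, 0 < u → DifferentiableAt ℝ G u)
    (hG0 : (∃ l : ℝ, Tendsto (deriv G) (𝓝[>] (0 : ℝ)) (𝓝 l)) ∨ Finite β) :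
    ∃ f : β → ℝ, Measurable f ∧ (∃ C : ℝ, ∀ y, |f y| ≤ C) ∧
      (MonotoneOn G (Ici 0) → ∀ y, f y ≤ 0) ∧ (AntitoneOn G (Ici 0) → ∀ y, 0 ≤ f y) ∧
      ∀ ρ : α × β → ℝ, IsDensity ρ → densityValue F G μ ν + ∫ y, f y ∂ν ≤
        ∫ x, (G (load F ν ρ x) + load (fun _ => f) ν ρ x) ∂μ := by
  obtain ⟨Cp, Cm, hCp, hCm, hmono, hanti, hpen⟩ :=
    exists_penalty (μ := μ) (ν := ν) hF hb hGc hG hG0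
  have key := exists_multiplier_of_penalty ν
    {p : Lp ℝ 2 ν × ℝ | ∃ ρ : α × β → ℝ, IsDensity ρ ∧ p.1 =ᵐ[ν] (fun y => marginal μ ρ y - 1) ∧
      densityCost F G μ ν ρ ≤ p.2} ?_ ?_ (densityValue F G μ ν) Cp Cm hCp hCm ?_
  · obtain ⟨f, hfm, hfb, hf⟩ := key
    have hfC : ∀ y, |f y| ≤ max Cp Cm := fun y => abs_le.2
      ⟨by linarith [(hfb y).1, le_max_right Cp Cm], (hfb y).2.trans (le_max_left _ _)⟩
    refine ⟨f, hfm, ⟨_, hfC⟩, fun h y => hmono h ▸ (hfb y).2, fun h y => ?_, fun ρ hρ => ?_⟩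
    · have := (hfb y).1
      rwa [hanti h, neg_zero] at this
    · obtain ⟨B, hB0, hB⟩ := hρ.bdd_nonneg
      have hL : MemLp (fun y => marginal μ ρ y - 1) 2 ν :=
        MemLp.of_bound ((hρ.measurable_marginal μ).sub measurable_const).aestronglyMeasurable
          (B + 1) (ae_of_all _ fun y => by
            have h1 := hρ.marginal_nonneg μ y
            have h2 := hρ.marginal_le (μ := μ) hB y
            rw [Real.norm_eq_abs, abs_le]
            constructor <;> linarith)
      have h := hf (hL.toLp, densityCost F G μ ν ρ) ⟨ρ, hρ, hL.coeFn_toLp, le_rfl⟩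
      have h1 : ∫ y, f y * (hL.toLp : Lp ℝ 2 ν) y ∂ν
          = ∫ y, f y * marginal μ ρ y ∂ν - ∫ y, f y ∂ν := by
        have hi : Integrable f ν := integrable_of_measurable_of_abs_le hfm hfC
        rw [← integral_sub ((hρ.integrable_marginal μ ν).bdd_mul hfm.aestronglyMeasurable
          (ae_of_all _ hfC)) hi]
        refine integral_congr_ae ?_
        filter_upwards [hL.coeFn_toLp] with y hy
        rw [hy]
        ring
      simp only at h
      rw [h1] at h
      rw [integral_add (integrable_comp_load hF hGc hG hρ) (integrable_load_of_bounded hfm hfC hρ),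
        integral_load_eq hfm hfC hρ]
      simp only [densityCost] at h
      linarith
  · rintro ⟨h₁, r₁⟩ ⟨ρ, hρ, hρ1, hρ2⟩ ⟨h₂, r₂⟩ ⟨σ, hσ, hσ1, hσ2⟩ s t hs ht hst
    refine ⟨fun p => s * ρ p + t * σ p, (hρ.const_mul hs).add (hσ.const_mul ht), ?_, ?_⟩
    · simp only at hρ1 hσ1
      have e1 := Lp.coeFn_add (s • h₁) (t • h₂)
      have e2 := Lp.coeFn_smul s h₁
      have e3 := Lp.coeFn_smul t h₂
      change ((s • h₁ + t • h₂ : Lp ℝ 2 ν) : β → ℝ) =ᵐ[ν] _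
      filter_upwards [e1, e2, e3, hρ1, hσ1] with y y1 y2 y3 y4 y5
      rw [y1, Pi.add_apply, y2, y3, Pi.smul_apply, Pi.smul_apply, y4, y5,
        (hρ.const_mul hs).marginal_add (hσ.const_mul ht), marginal_const_mul, marginal_const_mul,
        smul_eq_mul, smul_eq_mul]
      linear_combination -hst
    · refine (densityCost_convex hF hGc hG hρ hσ hs ht hst).trans ?_
      exact add_le_add (mul_le_mul_of_nonneg_left hρ2 hs) (mul_le_mul_of_nonneg_left hσ2 ht)
  · have hd : IsDensity fun p : α × β => (fun _ : β => (1 : ℝ)) p.2 :=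
      IsDensity.of_snd measurable_const (by simp) (B := 1) (by simp)
    refine ⟨(0, densityCost F G μ ν _), _, hd, ?_, le_rfl⟩
    filter_upwards [Lp.coeFn_zero ℝ 2 ν] with y hy
    rw [hy]
    simp [marginal]
  · rintro ⟨h, r⟩ ⟨ρ, hρ, h1, h2⟩
    simp only at h1 h2 ⊢
    have e1 : ∫ y, max (h y) 0 ∂ν = ∫ y, max (marginal μ ρ y - 1) 0 ∂ν := by
      refine integral_congr_ae ?_
      filter_upwards [h1] with y hy
      rw [hy]
    have e2 : ∫ y, max (-h y) 0 ∂ν = ∫ y, max (-(marginal μ ρ y - 1)) 0 ∂ν := by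
      refine integral_congr_ae ?_
      filter_upwards [h1] with y hy
      rw [hy]
    rw [e1, e2]
    exact (hpen ρ hρ).trans (add_le_add_left h2 _)

/-- A sequence of functions whose finite measurable selections have integral at least `W` admits
a common minorant whose integral is at least `W`. -/
lemma exists_integrable_minorant (μ : Measure α) {ψ : ℕ → α → ℝ} (hψm : ∀ i, Measurable (ψ i))
    (hψi : ∀ i, Integrable (ψ i) μ) {W : ℝ}
    (hW : ∀ j : α → ℕ, Measurable j → (∃ n, ∀ x, j x ≤ n) → W ≤ ∫ x, ψ (j x) x ∂μ) :
    ∃ φ : α → ℝ, Integrable φ μ ∧ (∀ᵐ x ∂μ, ∀ i, φ x ≤ ψ i x) ∧ W ≤ ∫ x, φ x ∂μ := by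
  classical
  let j : ℕ → α → ℕ := fun n => Nat.rec (fun _ => 0)
    (fun n jn x => if ψ (jn x) x ≤ ψ (n + 1) x then jn x else n + 1) n
  have hj : ∀ n x, j (n + 1) x = if ψ (j n x) x ≤ ψ (n + 1) x then j n x else n + 1 :=
    fun n x => rfl
  set θ : ℕ → α → ℝ := fun n x => ψ (j n x) x with hθ
  have hθs : ∀ n, θ (n + 1) = fun x => min (θ n x) (ψ (n + 1) x) := by
    intro n
    funext x
    simp only [hθ, hj]
    split_ifs with h
    · exact (min_eq_left h).symm
    · exact (min_eq_right (not_le.1 h).le).symm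
  have hθm : ∀ n, Measurable (θ n) := by
    intro n
    induction n with
    | zero => exact hψm 0
    | succ n ih => rw [hθs]; exact ih.min (hψm _)
  have hθi : ∀ n, Integrable (θ n) μ := by
    intro n
    induction n with
    | zero => exact hψi 0
    | succ n ih => rw [hθs]; exact ih.inf (hψi _)
  have hθa : Antitone θ := antitone_nat_of_succ_le fun n x => by
    rw [hθs]
    exact min_le_left _ _
  have hθψ : ∀ n x, θ n x ≤ ψ n x := by
    intro n x
    cases n with
    | zero => exact le_rfl
    | succ n => rw [hθs]; exact min_le_right _ _
  have hjm : ∀ n, Measurable (j n) := by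
    intro n
    induction n with
    | zero => exact measurable_const
    | succ n ih => exact Measurable.ite (measurableSet_le (hθm n) (hψm _)) ih measurable_const
  have hjb : ∀ n x, j n x ≤ n := by
    intro n x
    induction n with
    | zero => exact le_rfl
    | succ n ih =>
      rw [hj]
      split_ifs
      · exact ih.trans n.le_succ
      · exact le_rfl
  have hWθ : ∀ n, W ≤ ∫ x, θ n x ∂μ := fun n => hW (j n) (hjm n) ⟨n, hjb n⟩
  set D : α → ℝ≥0∞ := fun x => ⨆ n, ENNReal.ofReal (θ 0 x - θ n x) with hD
  have hDm : Measurable D := .iSup fun n => ((hθm 0).sub (hθm n)).ennreal_ofReal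
  have hDint : ∫⁻ x, D x ∂μ ≤ ENNReal.ofReal (∫ x, θ 0 x ∂μ - W) := by
    have hlim : ∫⁻ x, D x ∂μ = ⨆ n, ∫⁻ x, ENNReal.ofReal (θ 0 x - θ n x) ∂μ :=
      lintegral_iSup (fun n => ((hθm 0).sub (hθm n)).ennreal_ofReal)
        fun n m h x => ENNReal.ofReal_le_ofReal (sub_le_sub_left (hθa h x) _)
    rw [hlim]
    refine iSup_le fun n => ?_
    have hn := ofReal_integral_eq_lintegral_ofReal (f := fun x => θ 0 x - θ n x)
      ((hθi 0).sub (hθi n)) (ae_of_all _ fun x => sub_nonneg.2 (hθa (Nat.zero_le n) x))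
    rw [← hn]
    refine ENNReal.ofReal_le_ofReal ?_
    rw [integral_sub (hθi 0) (hθi n)]
    exact sub_le_sub_left (hWθ n) _
  have hDfin : ∫⁻ x, D x ∂μ ≠ ⊤ := (hDint.trans_lt ENNReal.ofReal_lt_top).ne
  have hDlt : ∀ᵐ x ∂μ, D x < ⊤ := ae_lt_top hDm hDfin
  have hDi : Integrable (fun x => (D x).toReal) μ := integrable_toReal_of_lintegral_ne_top
    hDm.aemeasurable hDfin
  refine ⟨fun x => θ 0 x - (D x).toReal, (hθi 0).sub hDi, ?_, ?_⟩
  · filter_upwards [hDlt] with x hx i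
    have h1 : ENNReal.ofReal (θ 0 x - θ i x) ≤ D x :=
      le_iSup (fun n => ENNReal.ofReal (θ 0 x - θ n x)) i
    have h2 := (ENNReal.ofReal_le_iff_le_toReal hx.ne).1 h1
    linarith [hθψ i x]
  · rw [integral_sub (hθi 0) hDi, integral_toReal hDm.aemeasurable hDlt]
    have h1 := ENNReal.toReal_mono ENNReal.ofReal_ne_top hDint
    rw [ENNReal.toReal_ofReal (sub_nonneg.2 (hWθ 0))] at h1
    linarith

lemma exists_minorant_of_densities (hF : IsWeight F a b) (hGc : ConvexOn ℝ (Ici 0) G)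
    (hG : ∀ u : ℝ, 0 < u → DifferentiableAt ℝ G u) {f : β → ℝ} (hf : Measurable f) {C : ℝ}
    (hC : ∀ y, |f y| ≤ C) {W : ℝ}
    (hW : ∀ ρ : α × β → ℝ, IsDensity ρ →
      W ≤ ∫ x, (G (load F ν ρ x) + load (fun _ => f) ν ρ x) ∂μ)
    {r : ℕ → β → ℝ} (hr : ∀ i, IsDensity fun p : α × β => r i p.2) :
    ∃ φ : α → ℝ, Integrable φ μ ∧ W ≤ ∫ x, φ x ∂μ ∧
      ∀ᵐ x ∂μ, ∀ i, φ x ≤ G (∫ y, F x y * r i y ∂ν) + ∫ y, f y * r i y ∂ν := by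
  have key := exists_integrable_minorant μ
    (ψ := fun i x => G (load F ν (fun p => r i p.2) x) + load (fun _ => f) ν (fun p => r i p.2) x)
    (fun i => (measurable_comp_load hF hG (hr i)).add (measurable_load_of_measurable hf (hr i)))
    (fun i => (integrable_comp_load hF hGc hG (hr i)).add
      (integrable_load_of_bounded hf hC (hr i))) (W := W) ?_
  · obtain ⟨φ, h1, h2, h3⟩ := key
    exact ⟨φ, h1, h3, h2⟩
  · rintro j hj ⟨n, hn⟩
    refine hW (fun p => r (j p.1) p.2) ⟨?_, fun p => (hr (j p.1)).nonneg p, ?_⟩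
    · have : Measurable fun q : (α × β) × ℕ => r q.2 q.1.2 :=
        measurable_from_prod_countable_left fun i => (hr i).meas
      exact this.comp (measurable_id.prodMk (hj.comp measurable_fst))
    · choose B hB using fun i => (hr i).bdd
      refine ⟨∑ i ∈ Finset.range (n + 1), |B i|, fun p => (hB (j p.1) p).trans ?_⟩
      exact (le_abs_self _).trans (Finset.single_le_sum (f := fun i => |B i|)
        (fun i _ => abs_nonneg _) (Finset.mem_range.2 (Nat.lt_succ_of_le (hn p.1))))

section Potential

variable [TopologicalSpace β] [SecondCountableTopology β] [BorelSpace β]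

lemma exists_generic_family (ν : Measure β) [NeZero ν] {f : β → ℝ} (hf : Measurable f) :
    ∃ A : ℕ → Set β, (∀ i, MeasurableSet (A i)) ∧ (∀ i, ν (A i) ≠ 0) ∧
      ∀ᵐ y ∂ν, ∀ q : ℝ, f y < q → ∀ U ∈ 𝓝 y, ∃ i, ∀ z ∈ A i, z ∈ U ∧ f z < q := by
  set T : TopologicalSpace.countableBasis β × ℚ → Set β :=
    fun p => (p.1 : Set β) ∩ {z | f z < p.2} with hT
  have hTm : ∀ p, MeasurableSet (T p) := fun p =>
    (TopologicalSpace.isOpen_of_mem_countableBasis p.1.2).measurableSet.inter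
      (measurableSet_lt hf measurable_const)
  have : Countable (TopologicalSpace.countableBasis β) :=
    (TopologicalSpace.countable_countableBasis β).to_subtype
  have hnull : ∀ᵐ y ∂ν, ∀ p, ν (T p) = 0 → y ∉ T p := by
    refine ae_all_iff.2 fun p => ?_
    by_cases h : ν (T p) = 0
    · filter_upwards [measure_eq_zero_iff_ae_notMem.1 h] with y hy _ using hy
    · exact ae_of_all _ fun y h' => absurd h' h
  have hex : ∀ y : β, (∀ p, ν (T p) = 0 → y ∉ T p) → ∀ q : ℝ, f y < q → ∀ U ∈ 𝓝 y,
      ∃ p, ν (T p) ≠ 0 ∧ ∀ z ∈ T p, z ∈ U ∧ f z < q := by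
    intro y hy q hq U hU
    obtain ⟨V, hV, hyV, hVU⟩ :=
      (TopologicalSpace.isBasis_countableBasis β).mem_nhds_iff.1 hU
    obtain ⟨r, hr1, hr2⟩ := exists_rat_btwn hq
    exact ⟨(⟨V, hV⟩, r), fun h => hy _ h ⟨hyV, hr1⟩, fun z hz => ⟨hVU hz.1, hz.2.trans hr2⟩⟩
  have hne : Nonempty {p // ν (T p) ≠ 0} := by
    obtain ⟨y, hy⟩ := hnull.exists
    obtain ⟨p, hp, -⟩ := hex y hy (f y + 1) (by linarith) univ univ_mem
    exact ⟨⟨p, hp⟩⟩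
  obtain ⟨e, he⟩ := exists_surjective_nat {p // ν (T p) ≠ 0}
  refine ⟨fun i => T (e i), fun i => hTm _, fun i => (e i).2, ?_⟩
  filter_upwards [hnull] with y hy q hq U hU
  obtain ⟨p, hp, hpU⟩ := hex y hy q hq U hU
  obtain ⟨i, hi⟩ := he ⟨p, hp⟩
  exact ⟨i, fun z hz => hpU z (by simpa [hi] using hz)⟩

/-- If a bound holds along a countable dense set of scales, then it holds for the best slope. -/
lemma le_add_mul_of_forall_rat (hGc : ConvexOn ℝ (Ici 0) G)
    (hG : ∀ u : ℝ, 0 < u → DifferentiableAt ℝ G u) {c k : ℝ} {v t : ℕ → ℝ} (hv : ∀ i, 0 < v i)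
    (hk : k = ⨅ i, t i / v i)
    (h : ∀ i, ∀ w : ℚ, 0 < w → c ≤ G (w * v i) + w * t i) {u : ℝ} (hu : 0 ≤ u) :
    c ≤ G u + k * u := by
  have hreal : ∀ i, ∀ w : ℝ, 0 < w → c ≤ G (w * v i) + w * t i := by
    intro i w hw
    have hcont : ContinuousAt (fun w : ℝ => G (w * v i) + w * t i) w :=
      ((hG _ (mul_pos hw (hv i))).continuousAt.comp (f := fun w : ℝ => w * v i)
        (continuous_id.mul continuous_const).continuousAt).add
        (continuous_id.mul continuous_const).continuousAt
    by_contra! hlt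
    have hev := (hcont.eventually_lt continuousAt_const hlt).and (lt_mem_nhds hw)
    obtain ⟨r, hr⟩ := Rat.isDenseEmbedding_coe_real.dense.inter_nhds_nonempty hev
    obtain ⟨⟨r, rfl⟩, hr1, hr2⟩ := hr
    exact absurd hr1 (not_lt.2 (h i r (by exact_mod_cast hr2)))
  have hpos : ∀ u : ℝ, 0 < u → c ≤ G u + k * u := by
    intro u hu
    have h1 : (c - G u) / u ≤ k := by
      rw [hk]
      refine le_ciInf fun i => ?_
      have h2 := hreal i (u / v i) (div_pos hu (hv i))
      rw [div_mul_cancel₀ _ (hv i).ne'] at h2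
      rw [div_le_iff₀ hu]
      have : t i / v i * u = u / v i * t i := by ring
      linarith
    rw [div_le_iff₀ hu] at h1
    linarith
  rcases hu.eq_or_lt with rfl | hu
  · rw [mul_zero, add_zero]
    have hlim : Tendsto (fun s : ℝ => (1 - s) * G 0 + s * G 1 + k * s) (𝓝[>] 0) (𝓝 (G 0)) := by
      have : Continuous fun s : ℝ => (1 - s) * G 0 + s * G 1 + k * s := by fun_prop
      simpa using (this.tendsto 0).mono_left nhdsWithin_le_nhds
    refine ge_of_tendsto hlim ?_
    filter_upwards [Ioo_mem_nhdsGT (one_pos : (0 : ℝ) < 1)] with s hs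
    have h1 := hGc.2 (x := 0) (y := 1) (by simp) (by simp) (sub_nonneg.2 hs.2.le) hs.1.le
      (by ring)
    simp only [smul_eq_mul, mul_zero, mul_one, zero_add] at h1
    linarith [hpos s hs.1]
  · exact hpos u hu

lemma exists_potential [Nonempty α] [MeasurableSingletonClass β] (hF : IsWeight F a b)
    (hFc : ∀ x, Continuous (F x)) (hb : 0 ≤ b) (hGc : ConvexOn ℝ (Ici 0) G)
    (hG : ∀ u : ℝ, 0 < u → DifferentiableAt ℝ G u)
    (hG0 : (∃ l : ℝ, Tendsto (deriv G) (𝓝[>] (0 : ℝ)) (𝓝 l)) ∨ Finite β) :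
    ∃ g : β → ℝ, Measurable g ∧ (∃ C : ℝ, ∀ y, |g y| ≤ C) ∧
      (MonotoneOn G (Ici 0) → ∀ y, g y ≤ 0) ∧ (AntitoneOn G (Ici 0) → ∀ y, 0 ≤ g y) ∧
      ∃ φ : α → ℝ, Integrable φ μ ∧ densityValue F G μ ν + ∫ y, g y ∂ν ≤ ∫ x, φ x ∂μ ∧
        ∀ᵐ x ∂μ, ∀ m : Measure β, IsFiniteMeasure m →
          φ x ≤ ∫ y, g y ∂m + G (∫ y, F x y ∂m) := by
  obtain ⟨f, hfm, ⟨C, hC⟩, hmono, hanti, hW⟩ :=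
    exists_multiplier (μ := μ) (ν := ν) hF hb hGc hG hG0
  obtain ⟨A, hAm, hA0, hA⟩ := exists_generic_family ν hfm
  have hfi : Integrable f ν := integrable_of_measurable_of_abs_le hfm hC
  have hFi : ∀ x, ∀ m : Measure β, IsFiniteMeasure m → Integrable (F x) m := fun x m _ =>
    integrable_of_measurable_of_abs_le (hF.measurable_right x) (hF.abs_le x)
  have hAr : ∀ i, 0 < ν.real (A i) := fun i => ENNReal.toReal_pos (hA0 i) (measure_ne_top _ _)
  set v : α → ℕ → ℝ := fun x i => ∫ y in A i, F x y ∂ν with hv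
  set t : ℕ → ℝ := fun i => ∫ y in A i, f y ∂ν with ht
  have hva : ∀ x i, a * ν.real (A i) ≤ v x i := fun x i =>
    setIntegral_ge_of_const_le_real (hAm i) (measure_ne_top _ _) (fun y _ => hF.lower x y)
      (hFi x ν inferInstance).integrableOn
  have hv0 : ∀ x i, 0 < v x i := fun x i => (mul_pos hF.pos (hAr i)).trans_le (hva x i)
  have hC0 : 0 ≤ C := by
    obtain ⟨y⟩ : Nonempty β := ν.nonempty_of_neZero
    exact (abs_nonneg _).trans (hC y)
  have htC : ∀ i, |t i| ≤ C * ν.real (A i) := fun i => by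
    rw [← Real.norm_eq_abs]
    exact norm_setIntegral_le_of_norm_le_const (measure_lt_top _ _) (fun y _ => hC y)
  have htv : ∀ x i, |t i / v x i| ≤ C / a := by
    intro x i
    rw [abs_div, abs_of_pos (hv0 x i), div_le_div_iff₀ (hv0 x i) hF.pos]
    have h1 := mul_le_mul_of_nonneg_right (htC i) hF.pos.le
    have h2 := mul_le_mul_of_nonneg_left (hva x i) hC0
    linarith
  have hbdd : ∀ x, BddBelow (range fun i => t i / v x i) := fun x =>
    ⟨-(C / a), by rintro _ ⟨i, rfl⟩; exact (abs_le.1 (htv x i)).1⟩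
  set k : α → ℝ := fun x => ⨅ i, t i / v x i with hk
  have hkC : ∀ x, |k x| ≤ C / a := fun x => abs_le.2
    ⟨le_ciInf fun i => (abs_le.1 (htv x i)).1,
      (ciInf_le (hbdd x) 0).trans (abs_le.1 (htv x 0)).2⟩
  have hkF : ∀ x y, |k x * F x y| ≤ C / a * b := fun x y => by
    rw [abs_mul]
    exact mul_le_mul (hkC x) (hF.abs_le x y) (abs_nonneg _) ((abs_nonneg _).trans (hkC x))
  have hbddg : ∀ y, BddAbove (range fun x => k x * F x y) := fun y =>
    ⟨C / a * b, by rintro _ ⟨x, rfl⟩; exact (abs_le.1 (hkF x y)).2⟩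
  set g : β → ℝ := fun y => ⨆ x, k x * F x y with hg
  have hgm : Measurable g := (lowerSemicontinuous_ciSup hbddg fun x =>
    (continuous_const.mul (hFc x)).lowerSemicontinuous).measurable
  have hgC : ∀ y, |g y| ≤ C / a * b := fun y => abs_le.2
    ⟨(abs_le.1 (hkF (Classical.arbitrary α) y)).1.trans (le_ciSup (hbddg y) _),
      ciSup_le fun x => (abs_le.1 (hkF x y)).2⟩
  have hgf : ∀ᵐ y ∂ν, g y ≤ f y := by
    filter_upwards [hA] with y hy
    refine ciSup_le fun x => le_of_forall_pos_le_add fun ε hε => ?_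
    obtain ⟨i, hi⟩ := hy (f y + ε / 2) (by linarith) {z | k x * F x y - ε / 2 < k x * F x z}
      ((continuous_const.mul (hFc x)).continuousAt.eventually (lt_mem_nhds (sub_lt_self (k x * F x y) (half_pos hε))))
    have h1 : (k x * F x y - ε / 2) * ν.real (A i) ≤ k x * v x i := by
      rw [hv, ← integral_const_mul]
      exact setIntegral_ge_of_const_le_real (hAm i) (measure_ne_top _ _) (fun z hz => (hi z hz).1.le)
        ((hFi x ν inferInstance).const_mul _).integrableOn
    have h2 : t i ≤ (f y + ε / 2) * ν.real (A i) := by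
      have := setIntegral_mono_on (g := fun _ => f y + ε / 2) hfi.integrableOn
        (integrable_const _).integrableOn (hAm i) fun z hz => (hi z hz).2.le
      simpa [mul_comm] using this
    have h3 : k x * v x i ≤ t i := (le_div_iff₀ (hv0 x i)).1 (ciInf_le (hbdd x) i)
    have := le_of_mul_le_mul_right ((h1.trans h3).trans h2) (hAr i)
    linarith
  have hgi : ∀ m : Measure β, IsFiniteMeasure m → Integrable g m := fun m _ =>
    integrable_of_measurable_of_abs_le hgm hgC
  refine ⟨g, hgm, ⟨_, hgC⟩, fun h y => ?_, fun h y => ?_, ?_⟩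
  · refine ciSup_le fun x => mul_nonpos_of_nonpos_of_nonneg ?_ (hF.nonneg x y)
    exact (ciInf_le (hbdd x) 0).trans (div_nonpos_of_nonpos_of_nonneg
      (integral_nonpos fun y => hmono h y) (hv0 x 0).le)
  · refine le_trans ?_ (le_ciSup (hbddg y) (Classical.arbitrary α))
    exact mul_nonneg (le_ciInf fun i => div_nonneg (integral_nonneg fun y => hanti h y)
      (hv0 _ i).le) (hF.nonneg _ y)
  · have : Nonempty {w : ℚ // 0 < w} := ⟨⟨1, one_pos⟩⟩
    obtain ⟨e, he⟩ := exists_surjective_nat (ℕ × {w : ℚ // 0 < w})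
    obtain ⟨φ, hφi, hφW, hφ⟩ := exists_minorant_of_densities (μ := μ) (ν := ν) hF hGc hG hfm hC hW
      (r := fun n => (A (e n).1).indicator fun _ => ((e n).2 : ℚ)) fun n => by
        have hw : (0 : ℝ) ≤ ((e n).2 : ℚ) := by exact_mod_cast (e n).2.2.le
        exact IsDensity.of_snd (measurable_const.indicator (hAm _))
          (fun y => indicator_nonneg (fun _ _ => hw) y) fun y => indicator_le_self' (fun _ _ => hw) y
    refine ⟨φ, hφi, ?_, ?_⟩
    · have := integral_mono_ae (hgi ν inferInstance) hfi hgf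
      linarith
    · filter_upwards [hφ] with x hx m hm
      have h1 := le_add_mul_of_forall_rat (c := φ x) hGc hG (hv0 x) (rfl : k x = _)
        (fun i w hw => by
          obtain ⟨n, hn⟩ := he (i, ⟨w, hw⟩)
          have h2 := hx n
          have h3 : ∀ h : β → ℝ, ∫ y, h y * (A (e n).1).indicator (fun _ => (((e n).2 : ℚ) : ℝ)) y ∂ν
              = w * ∫ y in A i, h y ∂ν := by
            intro h
            rw [hn, ← integral_indicator (hAm i), ← integral_const_mul]
            refine integral_congr_ae (ae_of_all _ fun y => ?_)
            by_cases hy : y ∈ A i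
            · simp [hy, mul_comm]
            · simp [hy]
          rw [h3, h3] at h2
          exact h2) (u := ∫ y, F x y ∂m) (integral_nonneg fun y => hF.nonneg x y)
      have h4 : k x * ∫ y, F x y ∂m ≤ ∫ y, g y ∂m := by
        rw [← integral_const_mul]
        exact integral_mono ((hFi x m hm).const_mul _) (hgi m hm) fun y => le_ciSup (hbddg y) x
      linarith

end Potential

end Densities

section Duality

variable {α β : Type*} [MeasurableSpace α] [MeasurableSpace β]

lemma isSFiniteKernel_of_isFiniteMeasure (κ : Kernel α β) (h : ∀ x, IsFiniteMeasure (κ x)) :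
    IsSFiniteKernel κ := by
  classical
  have hs : ∀ n : ℕ, MeasurableSet {x | ⌊(κ x univ).toReal⌋₊ = n} := fun n =>
    (Nat.measurable_floor.comp (κ.measurable_coe MeasurableSet.univ).ennreal_toReal)
      (measurableSet_singleton n)
  refine ⟨fun n => Kernel.piecewise (hs n) κ 0, fun n => ⟨(n : ℝ≥0∞) + 1, by simp, fun x => ?_⟩, ?_⟩
  · rw [Kernel.piecewise_apply]
    split_ifs with hx
    · have h1 := (Nat.lt_floor_add_one (κ x univ).toReal).le
      rw [show ⌊(κ x univ).toReal⌋₊ = n from hx] at h1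
      rw [← ENNReal.ofReal_toReal (measure_ne_top (κ x) univ)]
      refine (ENNReal.ofReal_le_ofReal h1).trans_eq ?_
      rw [ENNReal.ofReal_add n.cast_nonneg zero_le_one]
      simp
    · simp
  · ext x s hs
    rw [Kernel.sum_apply, Measure.sum_apply _ hs,
      tsum_eq_single ⌊(κ x univ).toReal⌋₊ fun n hn => ?_]
    · simp [Kernel.piecewise_apply]
    · have hx : x ∉ {x | ⌊(κ x univ).toReal⌋₊ = n} := fun h => hn (Eq.symm h)
      rw [Kernel.piecewise_apply, if_neg hx]
      simp

lemma epos_mono {x y : EReal} (h : x ≤ y) : epos x ≤ epos y := by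
  by_cases hy : y = ⊤
  · simp [epos, hy]
  · have hx : x ≠ ⊤ := fun hx => hy (top_le_iff.1 (hx ▸ h))
    simp only [epos, if_neg hx, if_neg hy]
    by_cases hb : x = ⊥
    · simp [hb]
    · exact ENNReal.ofReal_le_ofReal (EReal.toReal_le_toReal h hb hy)

lemma eintegral_mono_ae {μ : Measure α} {f g : α → EReal} (h : ∀ᵐ x ∂μ, f x ≤ g x) :
    eintegral μ f ≤ eintegral μ g := by
  refine EReal.sub_le_sub (EReal.coe_ennreal_le_coe_ennreal_iff.2 (lintegral_mono_ae ?_))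
    (EReal.coe_ennreal_le_coe_ennreal_iff.2 (lintegral_mono_ae ?_))
  · filter_upwards [h] with x hx using epos_mono hx
  · filter_upwards [h] with x hx using epos_mono (EReal.neg_le_neg_iff.2 hx)

lemma epos_coe (r : ℝ) : epos r = ENNReal.ofReal r := by simp [epos]

lemma epos_neg_coe (r : ℝ) : epos (-(r : EReal)) = ENNReal.ofReal (-r) := by
  rw [← EReal.coe_neg, epos_coe]

lemma eintegralR_eq (μ : Measure α) (f : α → ℝ) : eintegralR μ f =
    ((∫⁻ x, ENNReal.ofReal (f x) ∂μ : ℝ≥0∞) : EReal) -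
      ((∫⁻ x, ENNReal.ofReal (-f x) ∂μ : ℝ≥0∞) : EReal) := by
  simp only [eintegralR, eintegral, epos_coe, epos_neg_coe]

lemma eintegralR_of_integrable {μ : Measure α} {f : α → ℝ} (hf : Integrable f μ) :
    eintegralR μ f = ((∫ x, f x ∂μ : ℝ) : EReal) := by
  have h : ∫⁻ x, ENNReal.ofReal (-f x) ∂μ ≠ ⊤ := hf.neg.lintegral_lt_top.ne
  rw [eintegralR_eq, integral_eq_lintegral_pos_part_sub_lintegral_neg_part hf, EReal.coe_sub,
    EReal.coe_ennreal_toReal hf.lintegral_lt_top.ne,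
    EReal.coe_ennreal_toReal h]

lemma eintegralR_eq_top {μ : Measure α} {f h : α → ℝ} (hf : Measurable f)
    (hfi : ¬Integrable f μ) (hh : Integrable h μ) (hle : ∀ x, h x ≤ f x) :
    eintegralR μ f = ⊤ := by
  have h1 : ∫⁻ x, ENNReal.ofReal (-f x) ∂μ ≠ ⊤ :=
    ((lintegral_mono fun x => ENNReal.ofReal_le_ofReal (neg_le_neg (hle x))).trans_lt
      hh.neg.lintegral_lt_top).ne
  have h2 : ∫⁻ x, ENNReal.ofReal (f x) ∂μ = ⊤ := by
    by_contra h2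
    refine hfi ⟨hf.aestronglyMeasurable, ?_⟩
    rw [hasFiniteIntegral_iff_norm]
    calc ∫⁻ x, ENNReal.ofReal ‖f x‖ ∂μ
        ≤ ∫⁻ x, (ENNReal.ofReal (f x) + ENNReal.ofReal (-f x)) ∂μ := by
          refine lintegral_mono fun x => ?_
          rcases le_total 0 (f x) with h | h
          · rw [Real.norm_of_nonneg h]; exact le_self_add
          · rw [Real.norm_of_nonpos h]; exact le_add_self
      _ = ∫⁻ x, ENNReal.ofReal (f x) ∂μ + ∫⁻ x, ENNReal.ofReal (-f x) ∂μ :=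
          lintegral_add_left hf.ennreal_ofReal _
      _ < ⊤ := ENNReal.add_lt_top.2 ⟨Ne.lt_top h2, Ne.lt_top h1⟩
  rw [eintegralR_eq, h2, EReal.coe_ennreal_top, ← EReal.coe_ennreal_toReal h1, EReal.top_sub_coe]

/-- Fubini for bounded functions and a kernel with finite fibres. -/
lemma integrable_integral_of_bind {μ : Measure α} {ν : Measure β} [IsProbabilityMeasure ν]
    (κ : Kernel α β) (hκ : ∀ x, IsFiniteMeasure (κ x)) (hν : μ.bind κ = ν) {f : α → β → ℝ}
    (hf : Measurable (Function.uncurry f)) {C : ℝ} (hC : ∀ x y, |f x y| ≤ C) :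
    Measurable (fun x => ∫ y, f x y ∂κ x) ∧ Integrable (fun x => ∫ y, f x y ∂κ x) μ := by
  have := isSFiniteKernel_of_isFiniteMeasure κ hκ
  have hm : Measurable fun x => ∫ y, f x y ∂κ x :=
    (hf.stronglyMeasurable.integral_kernel_prod_right (κ := κ)).measurable
  have h1 : ∫⁻ x, κ x univ ∂μ = 1 := by
    rw [← Measure.bind_apply MeasurableSet.univ κ.aemeasurable, hν]
    exact measure_univ
  have hmass : Integrable (fun x => (κ x).real univ) μ := integrable_toReal_of_lintegral_ne_top
    (κ.measurable_coe MeasurableSet.univ).aemeasurable (by simp [h1])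
  refine ⟨hm, (hmass.const_mul C).mono' hm.aestronglyMeasurable (ae_of_all _ fun x => ?_)⟩
  exact norm_integral_le_of_norm_le_const (ae_of_all _ fun y => hC x y)

lemma integral_integral_of_bind {μ : Measure α} {ν : Measure β} [IsProbabilityMeasure ν]
    (κ : Kernel α β) (hν : μ.bind κ = ν) {g : β → ℝ} (hg : Integrable g ν) :
    ∫ x, ∫ y, g y ∂κ x ∂μ = ∫ y, g y ∂ν := by
  have h1 : (κ ∘ₖ Kernel.const Unit μ) () = ν := by
    rw [Kernel.comp_apply, Kernel.const_apply, hν]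
  have h2 := Kernel.integral_comp (κ := Kernel.const Unit μ) (η := κ) (a := ()) (f := g)
    (by rwa [h1])
  rw [h1, Kernel.const_apply] at h2
  exact h2.symm

end Duality

section TransportDuality

variable {F : X → Y → ℝ} {a b : ℝ} {G : ℝ → ℝ} {μ : Measure X} {ν : Measure Y}
  [IsProbabilityMeasure μ] [IsProbabilityMeasure ν]

lemma eintegral_KcL1_le (hF : IsWeight F a b) (hGc : ConvexOn ℝ (Ici 0) G)
    (hG : ∀ u : ℝ, 0 < u → DifferentiableAt ℝ G u) {g : Y → ℝ} (hg : Measurable g) {C : ℝ}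
    (hC : ∀ y, |g y| ≤ C) :
    eintegral μ (KcL1 (cGF F G) g) - ((∫ y, g y ∂ν : ℝ) : EReal)
      ≤ transportCost (cGF F G) μ ν := by
  refine le_sInf ?_
  rintro _ ⟨q, hq, hqν, rfl⟩
  refine EReal.sub_le_of_le_add ?_
  set κ : Kernel X Y := ⟨fun x => (q x : Measure Y), hq⟩ with hκ
  have hκf : ∀ x, IsFiniteMeasure (κ x) := fun x =>
    (inferInstance : IsFiniteMeasure (q x : Measure Y))
  have hκν : μ.bind κ = ν := hqν
  obtain ⟨hum, hui⟩ := integrable_integral_of_bind κ hκf hκν hF.meas hF.abs_le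
  obtain ⟨-, hgi⟩ := integrable_integral_of_bind κ hκf hκν (f := fun _ => g)
    (hg.comp measurable_snd) fun _ => hC
  have hgint : ∀ x, Integrable g (κ x) := fun x => integrable_of_measurable_of_abs_le hg hC
  have hcm : Measurable fun x => cGF F G x (q x) :=
    measurable_comp_of_differentiableAt_pos hG hum fun x => integral_nonneg fun y => hF.nonneg x y
  by_cases hci : Integrable (fun x => cGF F G x (q x)) μ
  · have h1 : eintegral μ (KcL1 (cGF F G) g)
        ≤ eintegralR μ fun x => ∫ y, g y ∂κ x + cGF F G x (q x) :=
      eintegral_mono_ae (ae_of_all _ fun x => iInf_le _ (⟨q x, hgint x⟩ :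
        {m : FiniteMeasure Y // Integrable g (m : Measure Y)}))
    refine h1.trans_eq ?_
    have hsum : Integrable (fun x => ∫ y, g y ∂κ x + cGF F G x (q x)) μ := hgi.add hci
    rw [eintegralR_of_integrable hsum, eintegralR_of_integrable hci, ← EReal.coe_add,
      integral_add hgi hci, integral_integral_of_bind κ hκν
        (integrable_of_measurable_of_abs_le hg hC), add_comm]
  · obtain ⟨c, d, -, hcd⟩ := exists_affine_le hGc hG
    rw [eintegralR_eq_top hcm hci ((integrable_const c).sub (hui.const_mul d)) fun x =>
      hcd _ (integral_nonneg fun y => hF.nonneg x y)]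
    simp

lemma transportCost_le_densityCost (hF : IsWeight F a b) (hGc : ConvexOn ℝ (Ici 0) G)
    (hG : ∀ u : ℝ, 0 < u → DifferentiableAt ℝ G u) {ρ : X × Y → ℝ} (hρ : IsDensity ρ)
    (hmarg : ∀ᵐ y ∂ν, marginal μ ρ y = 1) :
    transportCost (cGF F G) μ ν ≤ ((densityCost F G μ ν ρ : ℝ) : EReal) := by
  have hm : Measurable (Function.uncurry fun x y => ENNReal.ofReal (ρ (x, y))) :=
    hρ.meas.ennreal_ofReal
  set κ : Kernel X Y := (Kernel.const X ν).withDensity fun x y => ENNReal.ofReal (ρ (x, y))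
    with hκ
  have hκx : ∀ x, κ x = ν.withDensity fun y => ENNReal.ofReal (ρ (x, y)) := fun x => by
    rw [hκ, Kernel.withDensity_apply _ hm, Kernel.const_apply]
  have hfin : ∀ x, IsFiniteMeasure (κ x) := fun x => by
    rw [hκx]
    exact isFiniteMeasure_withDensity_ofReal (hρ.integrable_right x).2
  refine sInf_le ⟨fun x => (⟨κ x, hfin x⟩ : FiniteMeasure Y), κ.measurable, ?_, ?_⟩
  · change μ.bind κ = ν
    ext s hs
    rw [Measure.bind_apply hs κ.aemeasurable]
    calc ∫⁻ x, κ x s ∂μ = ∫⁻ x, ∫⁻ y in s, ENNReal.ofReal (ρ (x, y)) ∂ν ∂μ := by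
          simp only [hκx, withDensity_apply _ hs]
      _ = ∫⁻ y in s, ∫⁻ x, ENNReal.ofReal (ρ (x, y)) ∂μ ∂ν := lintegral_lintegral_swap hm.aemeasurable
      _ = ∫⁻ _ in s, 1 ∂ν := by
          refine lintegral_congr_ae (ae_restrict_of_ae ?_)
          filter_upwards [hmarg] with y hy
          rw [← ofReal_integral_eq_lintegral_ofReal (hρ.integrable_left y)
            (ae_of_all _ fun x => hρ.nonneg _)]
          rw [marginal] at hy
          rw [hy, ENNReal.ofReal_one]
      _ = ν s := by simp
  · rw [densityCost, ← eintegralR_of_integrable (integrable_comp_load hF hGc hG hρ)]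
    congr 1
    funext x
    simp only [cGF, load, FiniteMeasure.toMeasure_mk]
    have hmx : Measurable fun y => ENNReal.ofReal (ρ (x, y)) :=
      (hρ.meas.comp measurable_prodMk_left).ennreal_ofReal
    rw [hκx, integral_withDensity_eq_integral_toReal_smul hmx (by simp)]
    congr 1
    refine integral_congr_ae (ae_of_all _ fun y => ?_)
    simp only [ENNReal.toReal_ofReal (hρ.nonneg _), smul_eq_mul, mul_comm]

lemma transportCost_le_densityValue (hF : IsWeight F a b) (hGc : ConvexOn ℝ (Ici 0) G)
    (hG : ∀ u : ℝ, 0 < u → DifferentiableAt ℝ G u) :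
    transportCost (cGF F G) μ ν ≤ ((densityValue F G μ ν : ℝ) : EReal) := by
  by_contra! hlt
  obtain ⟨r, hr1, hr2⟩ := EReal.lt_iff_exists_real_btwn.1 hlt
  have hd : IsDensity fun p : X × Y => (fun _ : Y => (1 : ℝ)) p.2 :=
    IsDensity.of_snd measurable_const (by simp) (B := 1) (by simp)
  obtain ⟨_, ⟨ρ, hρ, hρm, rfl⟩, h⟩ := exists_lt_of_csInf_lt
    (s := {r | ∃ ρ, IsDensity ρ ∧ (∀ᵐ y ∂ν, marginal μ ρ y = 1) ∧ densityCost F G μ ν ρ = r})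
    ⟨_, _, hd, ae_of_all _ fun y => by simp [marginal], rfl⟩ (EReal.coe_lt_coe_iff.1 hr1)
  exact absurd ((transportCost_le_densityCost hF hGc hG hρ hρm).trans
    (EReal.coe_le_coe_iff.2 h.le)) (not_le.2 hr2)

end TransportDuality

/-- Theorem `thm:existencedualopt`: dual attainment for costs of the
form `c(x,m) = G(∫ F(x,y) m(dy))`, when `G'(0) > −∞`, or when `G'(0) = −∞` and `Y` is
finite.  Moreover the dual optimizer can be chosen nonpositive (resp. nonnegative) when
`G` is non-decreasing (resp. non-increasing) on `[0,∞)`. -/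
theorem dual_attainment_GF
    [CompactSpace X] [CompactSpace Y]
    (F : X → Y → ℝ) (hFcont : Continuous fun p : X × Y => F p.1 p.2)
    (hFpos : ∀ x y, 0 < F x y)
    (G : ℝ → ℝ) (hGconv : ConvexOn ℝ (Ici 0) G)
    (hGdiff : ∀ u : ℝ, 0 < u → DifferentiableAt ℝ G u)
    (hG0 : (∃ L : ℝ, Tendsto (deriv G) (𝓝[>] (0 : ℝ)) (𝓝 L)) ∨ Finite Y)
    (μ : Measure X) (ν : Measure Y)
    [IsProbabilityMeasure μ] [IsProbabilityMeasure ν] :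
    ∃ fbar : Y → ℝ, Measurable fbar ∧ (∃ C : ℝ, ∀ y, |fbar y| ≤ C) ∧
      transportCost (cGF F G) μ ν =
        eintegral μ (KcL1 (cGF F G) fbar) - ((∫ y, fbar y ∂ν : ℝ) : EReal) ∧
      (MonotoneOn G (Ici 0) → ∀ y, fbar y ≤ 0) ∧
      (AntitoneOn G (Ici 0) → ∀ y, 0 ≤ fbar y) := by
  obtain ⟨x₀⟩ : Nonempty X := μ.nonempty_of_neZero
  have : Nonempty X := ⟨x₀⟩
  obtain ⟨p, -, hp⟩ := isCompact_univ.exists_isMinOn univ_nonempty hFcont.continuousOn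
  obtain ⟨p', -, hp'⟩ := isCompact_univ.exists_isMaxOn univ_nonempty hFcont.continuousOn
  have hF : IsWeight F (F p.1 p.2) (F p'.1 p'.2) :=
    ⟨hFcont.measurable, hFpos _ _, fun x y => hp (mem_univ (x, y)),
      fun x y => hp' (mem_univ (x, y))⟩
  obtain ⟨g, hgm, ⟨C, hC⟩, hmono, hanti, φ, hφi, hφ, hle⟩ :=
    exists_potential (μ := μ) (ν := ν) hF (fun x => hFcont.comp (Continuous.prodMk_right x))
      (hFpos _ _).le hGconv hGdiff hG0
  refine ⟨g, hgm, ⟨C, hC⟩, le_antisymm ?_ (eintegral_KcL1_le hF hGconv hGdiff hgm hC), hmono,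
    hanti⟩
  refine (transportCost_le_densityValue hF hGconv hGdiff).trans ?_
  rw [EReal.le_sub_iff_add_le (.inl (EReal.coe_ne_bot _)) (.inl (EReal.coe_ne_top _)),
    ← EReal.coe_add]
  refine (EReal.coe_le_coe_iff.2 hφ).trans ?_
  rw [← eintegralR_of_integrable hφi]
  refine eintegral_mono_ae ?_
  filter_upwards [hle] with x hx
  exact le_iInf fun m => EReal.coe_le_coe_iff.2 (hx _ inferInstance)

end UWOT
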